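/- For every S ∈ 𝔖 the following are equivalent: (a) there exists a preprojective k(Γ,Λ)-module M satisfying S ∼ S_M; (b) the word w(S) ∈ W is reduced. Moreover, if S ≠ ∅ and S = T₁ ∨ ⋯ ∨ T_l where each T_i ∈ 𝔓 and l is the smallest possible, then either of (a), (b) is also equivalent to: (c) for every i with 0 < i ≤ l, the word w(T_i) ∈ W is reduced. -/

import Mathlib

namespace KP

/-! ## Quivers on a fixed vertex set `Fin n`.

An orientation is encoded by `Λ : Fin n → Fin n → ℕ`, where `Λ a b` is the number of
arrows from `a` to `b`.  The underlying graph is recorded by `edges Λ a b = Λ a b + Λ b a`. -/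

/-- The orientation `σ_x Λ` obtained by reversing every arrow incident with `x`. -/
def flipO {n : ℕ} (x : Fin n) (Λ : Fin n → Fin n → ℕ) : Fin n → Fin n → ℕ :=
  fun a b => if a = x ∨ b = x then Λ b a else Λ a b

/-- Number of edges of the underlying graph joining `a` and `b`. -/
def edges {n : ℕ} (Λ : Fin n → Fin n → ℕ) (a b : Fin n) : ℕ := Λ a b + Λ b a

/-- `x` is a sink: no arrow starts at `x`. -/
def IsSink {n : ℕ} (Λ : Fin n → Fin n → ℕ) (x : Fin n) : Prop := ∀ y, Λ x y = 0

/-- `S` is a `(+)`-admissible sequence of vertices on `(Γ, Λ)`. -/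
def Admissible {n : ℕ} (Λ : Fin n → Fin n → ℕ) : List (Fin n) → Prop
  | [] => True
  | x :: xs => IsSink Λ x ∧ Admissible (flipO x Λ) xs

/-- The orientation `Λ^S`. -/
def orientAfter {n : ℕ} (Λ : Fin n → Fin n → ℕ) : List (Fin n) → (Fin n → Fin n → ℕ)
  | [] => Λ
  | x :: xs => orientAfter (flipO x Λ) xs

/-- Elementary move: interchange two consecutive vertices not joined by an edge. -/
inductive SwapRel {n : ℕ} (E : Fin n → Fin n → ℕ) : List (Fin n) → List (Fin n) → Prop
  | swap (l₁ l₂ : List (Fin n)) (a b : Fin n) (h : E a b = 0) :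
      SwapRel E (l₁ ++ a :: b :: l₂) (l₁ ++ b :: a :: l₂)

/-- The equivalence `∼` on sequences of vertices: reflexive–transitive closure of the
(symmetric) relation `SwapRel`. -/
def Sim {n : ℕ} (E : Fin n → Fin n → ℕ) : List (Fin n) → List (Fin n) → Prop :=
  Relation.ReflTransGen (SwapRel E)

/-- The preorder `S ⪯ T` : `T ∼ S ++ U` for some `(+)`-admissible sequence `U` on `(Γ, Λ^S)`. -/
def Preceq {n : ℕ} (Λ : Fin n → Fin n → ℕ) (S T : List (Fin n)) : Prop :=
  ∃ U, Admissible (orientAfter Λ S) U ∧ Sim (edges Λ) T (S ++ U)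

/-- Support of a sequence of vertices. -/
def suppOf {n : ℕ} (S : List (Fin n)) : Set (Fin n) := {v | v ∈ S}

/-- The partial order on vertices: `x ≤ y` iff there is a path from `x` to `y` in `(Γ, Λ)`. -/
def PathLE {n : ℕ} (Λ : Fin n → Fin n → ℕ) (x y : Fin n) : Prop :=
  Relation.ReflTransGen (fun a b => Λ a b ≠ 0) x y

/-- A filter (up-closed set) of the poset `(Γ₀, Λ)`. -/
def IsFilter {n : ℕ} (Λ : Fin n → Fin n → ℕ) (F : Set (Fin n)) : Prop :=
  ∀ x ∈ F, ∀ y, PathLE Λ x y → y ∈ F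

/-- The principal filter `⟨x⟩`. -/
def upSet {n : ℕ} (Λ : Fin n → Fin n → ℕ) (x : Fin n) : Set (Fin n) := {y | PathLE Λ x y}

/-- The hull `H_Λ(F)`: the smallest filter containing `F` and every vertex joined
by an edge to a vertex of `F`. -/
def hull {n : ℕ} (Λ : Fin n → Fin n → ℕ) (F : Set (Fin n)) : Set (Fin n) :=
  {y | ∃ x, (x ∈ F ∨ ∃ z ∈ F, edges Λ z x ≠ 0) ∧ PathLE Λ x y}

/-- `segs` is a canonical form of `S` (Proposition 2.1): `S ∼ S₁S₂⋯S_r`, each segment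
consists of distinct vertices, is nonempty, and `Supp S_i = Supp (S_i S_{i+1} ⋯ S_r)`. -/
def Segments {n : ℕ} (Λ : Fin n → Fin n → ℕ) (S : List (Fin n))
    (segs : List (List (Fin n))) : Prop :=
  Admissible Λ segs.flatten ∧ Sim (edges Λ) S segs.flatten ∧
  (∀ seg ∈ segs, seg ≠ [] ∧ seg.Nodup) ∧
  ∀ i, i < segs.length → suppOf (segs.getD i []) = suppOf ((segs.drop i).flatten)

/-- `J` is (a representative of) the join `S ∨ T` (Definition 2.4):  the canonical form of `J`
has `Supp R_i = Supp S_i ∪ Supp T_i` (out-of-range segments read as `∅`). -/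
def IsJoin {n : ℕ} (Λ : Fin n → Fin n → ℕ) (S T J : List (Fin n)) : Prop :=
  ∃ CS CT CJ, Segments Λ S CS ∧ Segments Λ T CT ∧ Segments Λ J CJ ∧
    ∀ i, suppOf (CJ.getD i []) = suppOf (CS.getD i []) ∪ suppOf (CT.getD i [])

/-- `M` is (a representative of) the meet `S ∧ T` (Definition 2.4). -/
def IsMeet {n : ℕ} (Λ : Fin n → Fin n → ℕ) (S T M : List (Fin n)) : Prop :=
  ∃ CS CT CM, Segments Λ S CS ∧ Segments Λ T CT ∧ Segments Λ M CM ∧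
    ∀ i, suppOf (CM.getD i []) = suppOf (CS.getD i []) ∩ suppOf (CT.getD i [])

/-- `S` is (equivalent to) the join `T₁ ∨ ⋯ ∨ T_l` of the list of sequences `Ts`. -/
def IsJoinList {n : ℕ} (Λ : Fin n → Fin n → ℕ) : List (List (Fin n)) → List (Fin n) → Prop
  | [], S => S = []
  | T :: Ts, S => ∃ J, IsJoinList Λ Ts J ∧ IsJoin Λ T J S

/-- The segments of a canonical form of a principal sequence `S_{r,x}` (Definition 3.1). -/
def PrincipalSegs {n : ℕ} (Λ : Fin n → Fin n → ℕ) (segs : List (List (Fin n)))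
    (r : ℕ) (x : Fin n) : Prop :=
  segs.length = r ∧ 0 < r ∧
  (∀ i, i + 1 < r → suppOf (segs.getD i []) = hull Λ (suppOf (segs.getD (i+1) []))) ∧
  suppOf (segs.getD (r-1) []) = upSet Λ x

/-- `S ∼ S_{r,x}`, the principal `(+)`-admissible sequence of size `r` with
`Supp S_r = ⟨x⟩`. -/
def IsPrincipalSeq {n : ℕ} (Λ : Fin n → Fin n → ℕ) (r : ℕ) (x : Fin n)
    (S : List (Fin n)) : Prop :=
  ∃ segs, Segments Λ S segs ∧ PrincipalSegs Λ segs r x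

/-- `S` is a principal `(+)`-admissible sequence. -/
def IsPrincipal {n : ℕ} (Λ : Fin n → Fin n → ℕ) (S : List (Fin n)) : Prop :=
  ∃ r x, IsPrincipalSeq Λ r x S


/-! ## Representations of `(Γ, Λ)` over a field `k`. -/

/-- A (finite-dimensional) representation of the quiver `(Γ, Λ)` over `k`:
the space at vertex `x` is `Fin (d x) → k`, and each arrow carries a linear map. -/
structure Rep (k : Type) [Field k] (n : ℕ) (Λ : Fin n → Fin n → ℕ) where
  d : Fin n → ℕ
  f : ∀ a b : Fin n, Fin (Λ a b) → ((Fin (d a) → k) →ₗ[k] (Fin (d b) → k))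

variable {k : Type} [Field k] {n : ℕ}

/-- A morphism of representations. -/
structure RepHom {Λ : Fin n → Fin n → ℕ} (M N : Rep k n Λ) where
  g : ∀ x, (Fin (M.d x) → k) →ₗ[k] (Fin (N.d x) → k)
  comm : ∀ a b i v, g b (M.f a b i v) = N.f a b i (g a v)

/-- Isomorphism of representations. -/
def RepIso {Λ : Fin n → Fin n → ℕ} (M N : Rep k n Λ) : Prop :=
  ∃ g : ∀ x, (Fin (M.d x) → k) ≃ₗ[k] (Fin (N.d x) → k),
    ∀ a b i v, g b (M.f a b i v) = N.f a b i (g a v)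

/-- The zero representation. -/
def IsZeroRep {Λ : Fin n → Fin n → ℕ} (M : Rep k n Λ) : Prop := ∀ x, M.d x = 0

/-- Cast between the standard spaces. -/
def castL (k : Type) [Field k] {m m' : ℕ} (h : m = m') : (Fin m → k) ≃ₗ[k] (Fin m' → k) :=
  LinearEquiv.funCongrLeft k k (finCongr h.symm)

/-- The splitting `(Fin (m + p) → k) ≃ₗ (Fin m → k) × (Fin p → k)`. -/
def splitL (k : Type) [Field k] (m p : ℕ) : (Fin (m + p) → k) ≃ₗ[k] (Fin m → k) × (Fin p → k) :=
  (LinearEquiv.funCongrLeft k k finSumFinEquiv).trans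
    (LinearEquiv.sumArrowLequivProdArrow _ _ k k)

/-- Direct sum of two representations. -/
def dSum {Λ : Fin n → Fin n → ℕ} (M N : Rep k n Λ) : Rep k n Λ where
  d x := M.d x + N.d x
  f a b i :=
    (splitL k (M.d b) (N.d b)).symm.toLinearMap ∘ₗ
      (LinearMap.prodMap (M.f a b i) (N.f a b i)) ∘ₗ (splitL k (M.d a) (N.d a)).toLinearMap

/-- The zero representation (as an object). -/
def zeroRep (k : Type) [Field k] (n : ℕ) (Λ : Fin n → Fin n → ℕ) : Rep k n Λ where
  d _ := 0
  f _ _ _ := 0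

/-- Direct sum of a list of representations. -/
def dSumList {Λ : Fin n → Fin n → ℕ} (L : List (Rep k n Λ)) : Rep k n Λ :=
  L.foldr dSum (zeroRep k n Λ)

/-- `M` is indecomposable. -/
def Indecomp {Λ : Fin n → Fin n → ℕ} (M : Rep k n Λ) : Prop :=
  ¬ IsZeroRep M ∧ ∀ A B : Rep k n Λ, RepIso M (dSum A B) → IsZeroRep A ∨ IsZeroRep B

/-- `X` is a direct summand of `M`. -/
def IsSummand {Λ : Fin n → Fin n → ℕ} (X M : Rep k n Λ) : Prop :=
  ∃ Y, RepIso M (dSum X Y)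

/-! ### Reflection functors (on objects) -/

/-- Index type of the arrows ending at `x`. -/
abbrev Arin {n : ℕ} (Λ : Fin n → Fin n → ℕ) (x : Fin n) := Σ y : Fin n, Fin (Λ y x)

/-- Index type of the arrows starting at `x`. -/
abbrev Aout {n : ℕ} (Λ : Fin n → Fin n → ℕ) (x : Fin n) := Σ y : Fin n, Fin (Λ x y)

/-- The map `h : ⊕_{a : y → x} V(y) → V(x)` induced by the maps along the arrows ending at `x`. -/
noncomputable def inMap (Λ : Fin n → Fin n → ℕ) (M : Rep k n Λ) (x : Fin n) :
    ((p : Arin Λ x) → (Fin (M.d p.1) → k)) →ₗ[k] (Fin (M.d x) → k) :=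
  ∑ p : Arin Λ x, (M.f p.1 x p.2) ∘ₗ LinearMap.proj p

/-- The map `h' : V(x) → ⊕_{a : x → y} V(y)` induced by the maps along arrows starting at `x`. -/
def outMap (Λ : Fin n → Fin n → ℕ) (M : Rep k n Λ) (x : Fin n) :
    (Fin (M.d x) → k) →ₗ[k] ((p : Aout Λ x) → (Fin (M.d p.1) → k)) :=
  LinearMap.pi fun p => M.f x p.1 p.2

noncomputable def kerEquiv (Λ : Fin n → Fin n → ℕ) (M : Rep k n Λ) (x : Fin n) :
    LinearMap.ker (inMap Λ M x) ≃ₗ[k]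
      (Fin (Module.finrank k (LinearMap.ker (inMap Λ M x))) → k) :=
  (Module.finBasis k _).equivFun

noncomputable def cokerEquiv (Λ : Fin n → Fin n → ℕ) (M : Rep k n Λ) (x : Fin n) :
    (((p : Aout Λ x) → (Fin (M.d p.1) → k)) ⧸ LinearMap.range (outMap Λ M x)) ≃ₗ[k]
      (Fin (Module.finrank k (((p : Aout Λ x) → (Fin (M.d p.1) → k)) ⧸
        LinearMap.range (outMap Λ M x))) → k) :=
  (Module.finBasis k _).equivFun

/-- The positive reflection functor `F_x⁺` (on objects): the space at `x` is replaced
by the kernel of `inMap`, with the maps along the reversed arrows induced by inclusion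
followed by the projections. -/
noncomputable def reflPlus (x : Fin n) (Λ : Fin n → Fin n → ℕ) (M : Rep k n Λ) :
    Rep k n (flipO x Λ) where
  d z := if z = x then Module.finrank k (LinearMap.ker (inMap Λ M x)) else M.d z
  f a b i :=
    if ha : a = x then
      if hb : b = x then 0
      else
        (castL k (if_neg hb).symm).toLinearMap ∘ₗ
          (LinearMap.proj (φ := fun p : Arin Λ x => Fin (M.d p.1) → k)
            (⟨b, Fin.cast (by subst ha; simp [flipO]) i⟩ : Arin Λ x)) ∘ₗ
          (LinearMap.ker (inMap Λ M x)).subtype ∘ₗ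
          (kerEquiv Λ M x).symm.toLinearMap ∘ₗ (castL k (if_pos ha)).toLinearMap
    else
      if hb : b = x then 0
      else
        (castL k (if_neg hb).symm).toLinearMap ∘ₗ
          M.f a b (Fin.cast (by simp [flipO, ha, hb]) i) ∘ₗ
          (castL k (if_neg ha)).toLinearMap

/-- The negative reflection functor `F_x⁻` (on objects), presented as a map from
representations of `(Γ, σ_x Λ)` to representations of `(Γ, Λ)`: the space at `x` is
replaced by the cokernel of `outMap`. -/
noncomputable def reflMinus (x : Fin n) (Λ : Fin n → Fin n → ℕ)
    (N : Rep k n (flipO x Λ)) : Rep k n Λ where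
  d z := if z = x then
      Module.finrank k (((p : Aout (flipO x Λ) x) → (Fin (N.d p.1) → k)) ⧸
        LinearMap.range (outMap (flipO x Λ) N x))
    else N.d z
  f a b i :=
    if hb : b = x then
      if ha : a = x then 0
      else
        (castL k (if_pos hb).symm).toLinearMap ∘ₗ
          (cokerEquiv (flipO x Λ) N x).toLinearMap ∘ₗ
          (LinearMap.range (outMap (flipO x Λ) N x)).mkQ ∘ₗ
          (LinearMap.single k (fun p : Aout (flipO x Λ) x => Fin (N.d p.1) → k)
            (⟨a, Fin.cast (by subst hb; simp [flipO]) i⟩ : Aout (flipO x Λ) x)) ∘ₗ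
          (castL k (if_neg ha)).toLinearMap
    else
      if ha : a = x then 0
      else
        (castL k (if_neg hb).symm).toLinearMap ∘ₗ
          N.f a b (Fin.cast (by simp [flipO, ha, hb]) i) ∘ₗ
          (castL k (if_neg ha)).toLinearMap

/-- `F(S) = F_{x_s}⁺ ⋯ F_{x_1}⁺` applied to a representation. -/
noncomputable def FList : (S : List (Fin n)) → (Λ : Fin n → Fin n → ℕ) → Rep k n Λ →
    Rep k n (orientAfter Λ S)
  | [], _, M => M
  | x :: xs, Λ, M => FList xs (flipO x Λ) (reflPlus x Λ M)

/-- `S` annihilates `M` : `F(S) M = 0`. -/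
def Annihilates (Λ : Fin n → Fin n → ℕ) (S : List (Fin n)) (M : Rep k n Λ) : Prop :=
  IsZeroRep (FList S Λ M)

/-- `M` is preprojective: some `(+)`-admissible sequence annihilates it. -/
def Preprojective (Λ : Fin n → Fin n → ℕ) (M : Rep k n Λ) : Prop :=
  ∃ S, Admissible Λ S ∧ Annihilates Λ S M

/-- `S` is a shortest `(+)`-admissible sequence annihilating `M` : it annihilates `M` and no
proper subsequence of `S` annihilates `M`.  (This predicate is invariant under `∼`, so it
expresses `S ∼ S_M`.) -/
def IsShortestAnn (Λ : Fin n → Fin n → ℕ) (M : Rep k n Λ) (S : List (Fin n)) : Prop :=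
  Admissible Λ S ∧ Annihilates Λ S M ∧
  ∀ S', Admissible Λ S' → Annihilates Λ S' M → Preceq Λ S' S → Sim (edges Λ) S' S

/-- The simple representation `L_x` concentrated at the vertex `x`. -/
def simpleRep (Λ : Fin n → Fin n → ℕ) (x : Fin n) : Rep k n Λ where
  d z := if z = x then 1 else 0
  f _ _ _ := 0

/-- `M(S) = F_{x₁}⁻ F_{x₂}⁻ ⋯ F_{x_{s-1}}⁻ (L_{x_s})`, where `L_{x_s}` is the simple
(projective) module over `k(Γ, σ_{x_{s-1}} ⋯ σ_{x_1} Λ)` at the vertex `x_s`. -/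
noncomputable def Mof : (Λ : Fin n → Fin n → ℕ) → (S : List (Fin n)) → Rep k n Λ
  | Λ, [] => zeroRep k n Λ
  | Λ, [x] => simpleRep Λ x
  | Λ, x :: y :: ys => reflMinus x Λ (Mof (flipO x Λ) (y :: ys))

variable {n : ℕ}

/-! ## The Weyl group -/

/-- The simple reflection `σ_i` attached to a generalized Cartan matrix `A`,
as a linear endomorphism of `ℤⁿ` : `σ_i(v) = v - (∑ l, a_{il} v_l) e_i`. -/
def sigmaL (A : Fin n → Fin n → ℤ) (i : Fin n) : (Fin n → ℤ) →ₗ[ℤ] (Fin n → ℤ) where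
  toFun v := v - (∑ l, A i l * v l) • Pi.single i 1
  map_add' v w := by
    simp only [Pi.add_apply, mul_add, Finset.sum_add_distrib, add_smul]
    abel
  map_smul' c v := by
    simp only [Pi.smul_apply, smul_eq_mul, RingHom.id_apply, smul_sub]
    congr 1
    rw [smul_smul, Finset.mul_sum]
    congr 1
    exact Finset.sum_congr rfl fun l _ => by ring

theorem sigma_invol (A : Fin n → Fin n → ℤ) (hA : ∀ i, A i i = 2) (i : Fin n) :
    (sigmaL A i).comp (sigmaL A i) = LinearMap.id := by
  apply LinearMap.ext
  intro v
  simp only [LinearMap.comp_apply, LinearMap.id_apply, sigmaL, LinearMap.coe_mk, AddHom.coe_mk]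
  set c := ∑ l, A i l * v l with hc
  set s : Fin n → ℤ := Pi.single i 1 with hs
  have h1 : ∑ l, A i l * (v - c • s) l = -c := by
    have h2 : ∀ l, A i l * (v - c • s) l = A i l * v l - c * (A i l * s l) := fun l => by
      simp only [Pi.sub_apply, Pi.smul_apply, smul_eq_mul]
      ring
    rw [Finset.sum_congr rfl fun l _ => h2 l, Finset.sum_sub_distrib, ← Finset.mul_sum]
    have h3 : ∑ l, A i l * s l = 2 := by
      rw [Finset.sum_eq_single i]
      · simp [hs, hA i]
      · intro b _ hb
        simp [hs, Pi.single_eq_of_ne hb]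
      · simp
    rw [h3, ← hc]
    ring
  rw [h1]
  ext j
  simp only [Pi.sub_apply, Pi.smul_apply, smul_eq_mul]
  ring

/-- The simple reflection `σ_i` as an automorphism of `ℤⁿ`. -/
def sigmaE (A : Fin n → Fin n → ℤ) (hA : ∀ i, A i i = 2) (i : Fin n) :
    (Fin n → ℤ) ≃ₗ[ℤ] (Fin n → ℤ) :=
  LinearEquiv.ofLinear (sigmaL A i) (sigmaL A i) (sigma_invol A hA i) (sigma_invol A hA i)

/-- The length `ℓ(w)`: the least `l ≥ 0` such that `w` is a product of `l` simple
reflections. -/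
noncomputable def wordLen (A : Fin n → Fin n → ℤ) (hA : ∀ i, A i i = 2)
    (w : (Fin n → ℤ) ≃ₗ[ℤ] (Fin n → ℤ)) : ℕ :=
  sInf {l | ∃ ys : List (Fin n), ys.length = l ∧ w = (ys.map (sigmaE A hA)).prod}

/-- The word `w(S) = σ_{x_s} ⋯ σ_{x_1}` associated to a sequence `S = x₁, …, x_s`. -/
def wordOf (A : Fin n → Fin n → ℤ) (hA : ∀ i, A i i = 2) (S : List (Fin n)) :
    (Fin n → ℤ) ≃ₗ[ℤ] (Fin n → ℤ) :=
  ((S.reverse).map (sigmaE A hA)).prod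

/-- The symmetric generalized Cartan matrix of the underlying graph of `(Γ, Λ)`. -/
def cartanOf (Λ : Fin n → Fin n → ℕ) : Fin n → Fin n → ℤ :=
  fun i j => if i = j then 2 else -(edges Λ i j : ℤ)

theorem cartan_diag (Λ : Fin n → Fin n → ℕ) : ∀ i, cartanOf Λ i i = 2 := by
  intro i; simp [cartanOf]

/-- The simple reflections of the Weyl group of the underlying graph of `(Γ, Λ)`. -/
def wSig (Λ : Fin n → Fin n → ℕ) : Fin n → ((Fin n → ℤ) ≃ₗ[ℤ] (Fin n → ℤ)) :=
  sigmaE (cartanOf Λ) (cartan_diag Λ)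

/-- `w(S)` for a sequence of vertices of `(Γ, Λ)`. -/
def wordOfSeq (Λ : Fin n → Fin n → ℕ) (S : List (Fin n)) :
    (Fin n → ℤ) ≃ₗ[ℤ] (Fin n → ℤ) :=
  ((S.reverse).map (wSig Λ)).prod

/-- The word `w(S)` is reduced: `ℓ(w(S))` equals the number of letters of `S`. -/
noncomputable def IsReducedSeq (Λ : Fin n → Fin n → ℕ) (S : List (Fin n)) : Prop :=
  wordLen (cartanOf Λ) (cartan_diag Λ) (wordOfSeq Λ S) = S.length

/-! ## Dynkin graphs of types A, D, E -/

def edgeA (n : ℕ) : Fin n → Fin n → ℕ := fun i j =>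
  if (i : ℕ) + 1 = (j : ℕ) ∨ (j : ℕ) + 1 = (i : ℕ) then 1 else 0

def edgeD (n : ℕ) : Fin n → Fin n → ℕ := fun i j =>
  if ((i : ℕ) = 0 ∧ (j : ℕ) = 2) ∨ ((j : ℕ) = 0 ∧ (i : ℕ) = 2) ∨
     ((i : ℕ) = 1 ∧ (j : ℕ) = 2) ∨ ((j : ℕ) = 1 ∧ (i : ℕ) = 2) ∨
     (2 ≤ (i : ℕ) ∧ (i : ℕ) + 1 = (j : ℕ)) ∨ (2 ≤ (j : ℕ) ∧ (j : ℕ) + 1 = (i : ℕ))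
  then 1 else 0

def edgeE (n : ℕ) : Fin n → Fin n → ℕ := fun i j =>
  if ((i : ℕ) + 1 = (j : ℕ) ∧ (j : ℕ) ≤ n - 2) ∨ ((j : ℕ) + 1 = (i : ℕ) ∧ (i : ℕ) ≤ n - 2) ∨
     ((i : ℕ) = 2 ∧ (j : ℕ) = n - 1) ∨ ((j : ℕ) = 2 ∧ (i : ℕ) = n - 1)
  then 1 else 0

/-- The underlying graph (given by its edge-count function `E`) is a Dynkin diagram of
type `A`, `D`, or `E`. -/
def IsDynkinADE (n : ℕ) (E : Fin n → Fin n → ℕ) : Prop :=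
  ∃ e : Fin n ≃ Fin n,
    (∀ i j, E i j = edgeA n (e i) (e j)) ∨
    (4 ≤ n ∧ ∀ i j, E i j = edgeD n (e i) (e j)) ∨
    ((n = 6 ∨ n = 7 ∨ n = 8) ∧ ∀ i j, E i j = edgeE n (e i) (e j))

/-! ## Coxeter-sortable elements -/

/-- Lexicographic comparison of index tuples. -/
def lexLE {s : ℕ} (ι ι' : Fin s → ℕ) : Prop :=
  ι = ι' ∨ ∃ j, (∀ j', j' < j → ι j' = ι' j') ∧ ι j < ι' j

/-- `w` is `c`-sortable for the Coxeter element determined by the half-infinite word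
`cseq` (with dividers every `blockLen` letters): the lexicographically first subsequence
of `cseq` that is a reduced word for `w` defines a sequence of subsets (between adjacent
dividers) that is decreasing under inclusion. -/
def CSortable (A : Fin n → Fin n → ℤ) (hA : ∀ i, A i i = 2) (cseq : ℕ → Fin n)
    (blockLen : ℕ) (w : (Fin n → ℤ) ≃ₗ[ℤ] (Fin n → ℤ)) : Prop :=
  ∃ (s : ℕ) (ι : Fin s → ℕ), StrictMono ι ∧
    w = ((List.ofFn fun j => cseq (ι j)).map (sigmaE A hA)).prod ∧
    wordLen A hA w = s ∧
    (∀ ι' : Fin s → ℕ, StrictMono ι' →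
      w = ((List.ofFn fun j => cseq (ι' j)).map (sigmaE A hA)).prod → lexLE ι ι') ∧
    ∀ m : ℕ, {a : Fin n | ∃ j, (ι j) / blockLen = m + 1 ∧ cseq (ι j) = a} ⊆
             {a : Fin n | ∃ j, (ι j) / blockLen = m ∧ cseq (ι j) = a}


/-- A nonzero non-isomorphism between representations. -/
def RepStep {k : Type} [Field k] {n : ℕ} {Λ : Fin n → Fin n → ℕ} (X Y : Rep k n Λ) : Prop :=
  ∃ f : RepHom X Y, (∃ x v, f.g x v ≠ 0) ∧ ¬ ∀ x, Function.Bijective (f.g x)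

/-- `v` is a minimal element of `D` in the poset `(Γ₀, Λ)`. -/
def MinimalIn {n : ℕ} (Λ : Fin n → Fin n → ℕ) (D : Set (Fin n)) (v : Fin n) : Prop :=
  v ∈ D ∧ ∀ u ∈ D, PathLE Λ u v → u = v

/-- The pairs `(h, v)` of Proposition 3.2(a): `0 < h ≤ r` and `v` a minimal element of
`Supp S_h \ H_Λ(Supp S_{h+1})` (with `Supp S_{r+1} = ∅`). -/
def JoinPair {n : ℕ} (Λ : Fin n → Fin n → ℕ) (segs : List (List (Fin n)))
    (p : ℕ × Fin n) : Prop :=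
  0 < p.1 ∧ p.1 ≤ segs.length ∧
  MinimalIn Λ (suppOf (segs.getD (p.1 - 1) []) \ hull Λ (suppOf (segs.getD p.1 []))) p.2

end KP

namespace KP
set_option linter.unusedSimpArgs false

section Weyl

variable {n : ℕ}

/-- The functional `v ↦ ∑ a_{il} v_l`. -/
def rho (A : Fin n → Fin n → ℤ) (i : Fin n) : (Fin n → ℤ) →ₗ[ℤ] ℤ where
  toFun v := ∑ l, A i l * v l
  map_add' v w := by simp [mul_add, Finset.sum_add_distrib]
  map_smul' c v := by
    simp only [Pi.smul_apply, smul_eq_mul, RingHom.id_apply, Finset.mul_sum]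
    exact Finset.sum_congr rfl fun l _ => by ring

/-- The simple root. -/
def sroot (i : Fin n) : Fin n → ℤ := Pi.single i 1

theorem rho_apply (A : Fin n → Fin n → ℤ) (i : Fin n) (v : Fin n → ℤ) :
    rho A i v = ∑ l, A i l * v l := rfl

theorem rho_sroot (A : Fin n → Fin n → ℤ) (i j : Fin n) : rho A i (sroot j) = A i j := by
  simp [rho_apply, sroot, Pi.single_apply]

theorem sroot_nonneg (i : Fin n) : 0 ≤ sroot i := by
  intro j
  by_cases h : j = i <;> simp [sroot, Pi.single_apply, h]

theorem sroot_ne_zero (i : Fin n) : sroot i ≠ 0 := by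
  intro h
  have := congrFun h i
  simp [sroot] at this

theorem sroot_self (i : Fin n) : sroot i i = 1 := by simp [sroot]
theorem sroot_of_ne {i j : Fin n} (h : j ≠ i) : sroot i j = 0 := by simp [sroot, h]

theorem sigmaE_apply (A : Fin n → Fin n → ℤ) (hA : ∀ i, A i i = 2) (i : Fin n) (v : Fin n → ℤ) :
    sigmaE A hA i v = v - rho A i v • sroot i := rfl

theorem sigmaE_of_ne (A : Fin n → Fin n → ℤ) (hA : ∀ i, A i i = 2) (i : Fin n) (v : Fin n → ℤ)
    {j : Fin n} (h : j ≠ i) : sigmaE A hA i v j = v j := by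
  simp [sigmaE_apply, sroot_of_ne h]

theorem sigmaE_self (A : Fin n → Fin n → ℤ) (hA : ∀ i, A i i = 2) (i : Fin n) (v : Fin n → ℤ) :
    sigmaE A hA i v i = v i - rho A i v := by
  simp [sigmaE_apply, sroot_self]

theorem sigmaE_sigmaE (A : Fin n → Fin n → ℤ) (hA : ∀ i, A i i = 2) (i : Fin n) (v : Fin n → ℤ) :
    sigmaE A hA i (sigmaE A hA i v) = v := by
  simp only [sigmaE_apply, map_sub, map_smul, rho_sroot, hA, smul_eq_mul]
  module

theorem sigmaE_sroot_self (A : Fin n → Fin n → ℤ) (hA : ∀ i, A i i = 2) (i : Fin n) :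
    sigmaE A hA i (sroot i) = - sroot i := by
  simp only [sigmaE_apply, rho_sroot, hA]
  module

theorem sigmaE_comm (A : Fin n → Fin n → ℤ) (hA : ∀ i, A i i = 2) (i j : Fin n)
    (h : A i j = 0) (h' : A j i = 0) (v : Fin n → ℤ) :
    sigmaE A hA i (sigmaE A hA j v) = sigmaE A hA j (sigmaE A hA i v) := by
  simp only [sigmaE_apply, map_sub, map_smul, rho_sroot, h, h', smul_eq_mul]
  module

theorem sigmaE_braid (A : Fin n → Fin n → ℤ) (hA : ∀ i, A i i = 2) (s t : Fin n)
    (h : A s t = -1) (h' : A t s = -1) (v : Fin n → ℤ) :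
    sigmaE A hA t (sigmaE A hA s (sigmaE A hA t (sigmaE A hA s v))) =
      sigmaE A hA s (sigmaE A hA t v) := by
  simp only [sigmaE_apply, map_sub, map_smul, rho_sroot, h, h', hA, smul_eq_mul]
  module

/-- Product of simple reflections along a word. -/
def pw (A : Fin n → Fin n → ℤ) (hA : ∀ i, A i i = 2) (ys : List (Fin n)) :
    (Fin n → ℤ) ≃ₗ[ℤ] (Fin n → ℤ) := (ys.map (sigmaE A hA)).prod

variable (A : Fin n → Fin n → ℤ) (hA : ∀ i, A i i = 2)

theorem pw_nil : pw A hA [] = 1 := rfl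
theorem pw_nil_apply (v : Fin n → ℤ) : pw A hA [] v = v := rfl
theorem pw_cons (x : Fin n) (xs : List (Fin n)) : pw A hA (x :: xs) = sigmaE A hA x * pw A hA xs := by
  simp [pw]
theorem pw_cons_apply (x : Fin n) (xs : List (Fin n)) (v : Fin n → ℤ) :
    pw A hA (x :: xs) v = sigmaE A hA x (pw A hA xs v) := by
  rw [pw_cons]; rfl
theorem pw_append (xs ys : List (Fin n)) : pw A hA (xs ++ ys) = pw A hA xs * pw A hA ys := by
  simp [pw]
theorem pw_append_apply (xs ys : List (Fin n)) (v : Fin n → ℤ) :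
    pw A hA (xs ++ ys) v = pw A hA xs (pw A hA ys v) := by
  rw [pw_append]; rfl

theorem sigmaE_mul_self (i : Fin n) : sigmaE A hA i * sigmaE A hA i = 1 := by
  apply LinearEquiv.ext
  intro v
  exact sigmaE_sigmaE A hA i v

theorem pw_reverse (xs : List (Fin n)) : pw A hA xs.reverse = (pw A hA xs)⁻¹ := by
  induction xs with
  | nil => simp [pw]
  | cons x xs ih =>
    rw [List.reverse_cons, pw_append, ih, pw_cons _ _ x [], pw_cons _ _ x xs, mul_inv_rev, pw_nil,
      mul_one]
    congr 1

theorem wordLen_le (ys : List (Fin n)) : wordLen A hA (pw A hA ys) ≤ ys.length :=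
  Nat.sInf_le ⟨ys, rfl, rfl⟩

theorem wordLen_exists (ys : List (Fin n)) :
    ∃ zs : List (Fin n), zs.length = wordLen A hA (pw A hA ys) ∧ pw A hA ys = pw A hA zs :=
  Nat.sInf_mem (s := {l | ∃ zs : List (Fin n), zs.length = l ∧
    pw A hA ys = (zs.map (sigmaE A hA)).prod}) ⟨_, ys, rfl, rfl⟩

/-- A word is reduced. -/
def Red (ys : List (Fin n)) : Prop := ∀ zs, pw A hA zs = pw A hA ys → ys.length ≤ zs.length

theorem red_iff (ys : List (Fin n)) : Red A hA ys ↔ wordLen A hA (pw A hA ys) = ys.length := by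
  constructor
  · intro h
    obtain ⟨zs, h1, h2⟩ := wordLen_exists A hA ys
    have := h zs h2.symm
    have := wordLen_le A hA ys
    omega
  · intro h zs hz
    have := wordLen_le A hA zs
    rw [hz] at this
    omega

theorem Red.left {xs ys : List (Fin n)} (h : Red A hA (xs ++ ys)) : Red A hA xs := by
  intro zs hz
  have := h (zs ++ ys) (by rw [pw_append, pw_append, hz])
  simp at this
  exact this

theorem Red.right {xs ys : List (Fin n)} (h : Red A hA (xs ++ ys)) : Red A hA ys := by
  intro zs hz
  have := h (xs ++ zs) (by rw [pw_append, pw_append, hz])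
  simp at this
  exact this

theorem Red.congr {xs ys : List (Fin n)} (h : Red A hA xs) (h1 : pw A hA xs = pw A hA ys)
    (h2 : ys.length ≤ xs.length) : Red A hA ys := by
  intro zs hz
  exact h2.trans (h zs (hz.trans h1.symm))

theorem Red.reverse {xs : List (Fin n)} (h : Red A hA xs) : Red A hA xs.reverse := by
  intro zs hz
  have := h zs.reverse (by rw [pw_reverse, hz, pw_reverse, inv_inv])
  simpa using this

theorem red_nil : Red A hA [] := fun zs _ => by simp

theorem det_sigmaE (i : Fin n) : LinearEquiv.det (sigmaE A hA i) = -1 := by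
  have h : (sigmaE A hA i : (Fin n → ℤ) →ₗ[ℤ] (Fin n → ℤ)) =
      LinearMap.transvection (rho A i) (-sroot i) := by
    apply LinearMap.ext
    intro v
    simp [sigmaE_apply, LinearMap.transvection.apply, sub_eq_add_neg]
  apply Units.ext
  rw [LinearEquiv.coe_det, h, LinearMap.transvection.det]
  simp [rho_sroot, hA]

theorem det_pw (ys : List (Fin n)) : LinearEquiv.det (pw A hA ys) = (-1) ^ ys.length := by
  induction ys with
  | nil => simp [pw]
  | cons x xs ih => rw [pw_cons, map_mul, ih, det_sigmaE, List.length_cons, pow_succ, mul_comm]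

theorem parity {xs ys : List (Fin n)} (h : pw A hA xs = pw A hA ys) :
    Even xs.length ↔ Even ys.length := by
  have h1 := congrArg LinearEquiv.det h
  rw [det_pw, det_pw] at h1
  rcases Nat.even_or_odd xs.length with hx | hx <;> rcases Nat.even_or_odd ys.length with hy | hy
  · tauto
  · rw [hx.neg_one_pow, hy.neg_one_pow] at h1
    exact absurd h1 (by decide)
  · rw [hx.neg_one_pow, hy.neg_one_pow] at h1
    exact absurd h1 (by decide)
  · simp [Nat.not_even_iff_odd.2 hx, Nat.not_even_iff_odd.2 hy]

/-- If `v` is reduced but `v s` is not then `v` has a word ending in `s` of the same length. -/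
theorem not_red_append {v : List (Fin n)} {s : Fin n}
    (h' : ¬ Red A hA (v ++ [s])) :
    ∃ v', pw A hA (v' ++ [s]) = pw A hA v ∧ v'.length + 1 ≤ v.length := by
  unfold Red at h'
  push Not at h'
  obtain ⟨zs, h1, h2⟩ := h'
  refine ⟨zs, ?_, ?_⟩
  · rw [pw_append, h1, pw_append, mul_assoc, pw_cons, pw_nil, mul_one, sigmaE_mul_self, mul_one]
  · have := parity A hA h1
    simp only [List.length_append, List.length_cons, List.length_nil] at this h2
    have h3 : zs.length ≠ v.length := by
      intro h
      rw [h] at this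
      simp only [zero_add, Nat.even_add_one] at this
      tauto
    omega

theorem pw_ss (s : Fin n) (us : List (Fin n)) : pw A hA (s :: s :: us) = pw A hA us := by
  rw [pw_cons, pw_cons, ← mul_assoc, sigmaE_mul_self, one_mul]

theorem not_red_ss (s : Fin n) (us : List (Fin n)) : ¬ Red A hA (s :: s :: us) := by
  intro h
  have := h us (pw_ss A hA s us).symm
  simp at this

end Weyl

section Tits

variable {n : ℕ} (A : Fin n → Fin n → ℤ) (hA : ∀ i, A i i = 2)

theorem rank_two_small (s t : Fin n) (hst : A s t = A t s)
    (h01 : A s t = 0 ∨ A s t = -1) (u : List (Fin n)) (hu : ∀ x ∈ u, x = s ∨ x = t)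
    (hred : Red A hA (u ++ [s])) :
    u = [] ∨ u = [t] ∨ (A s t = -1 ∧ u = [s, t]) := by
  induction u with
  | nil => simp
  | cons x u ih =>
    have hred' : Red A hA (u ++ [s]) := Red.right A hA (xs := [x]) hred
    have hx := hu x (by simp)
    rcases ih (fun y hy => hu y (by simp [hy])) hred' with h | h | ⟨hm, h⟩
    · subst h
      rcases hx with rfl | rfl
      · exact absurd hred (not_red_ss A hA _ _)
      · simp
    · subst h
      rcases hx with rfl | rfl
      · rcases h01 with h0 | h1
        · exfalso
          have := hred [t] (by
            apply LinearEquiv.ext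
            intro v
            simp only [List.cons_append, List.nil_append, pw_cons_apply, pw_nil_apply]
            rw [sigmaE_comm A hA t x (hst ▸ h0) h0, sigmaE_sigmaE])
          simp at this
        · simp [h1]
      · exact absurd hred (not_red_ss A hA _ _)
    · subst h
      rcases hx with rfl | rfl
      · exact absurd hred (not_red_ss A hA _ _)
      · exfalso
        have := hred [s, x] (by
          apply LinearEquiv.ext
          intro v
          simp only [List.cons_append, List.nil_append, pw_cons_apply, pw_nil_apply]
          rw [sigmaE_braid A hA s x hm (hst ▸ hm)])
        simp at this

theorem rank_two_big (s t : Fin n) (hne : s ≠ t) (hst : A s t = A t s)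
    (h2 : A s t ≤ -2) (u : List (Fin n)) (hu : ∀ x ∈ u, x = s ∨ x = t)
    (hred : Red A hA (u ++ [s])) :
    ∃ a b : ℤ, 0 ≤ a ∧ 0 ≤ b ∧ pw A hA u (sroot s) = a • sroot s + b • sroot t ∧
      (((u ++ [s]).head? = some s ∧ b ≤ a) ∨ ((u ++ [s]).head? = some t ∧ a ≤ b)) := by
  induction u with
  | nil => exact ⟨1, 0, by simp [pw_nil_apply]⟩
  | cons x u ih =>
    have hred' : Red A hA (u ++ [s]) := Red.right A hA (xs := [x]) hred
    have hx := hu x (by simp)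
    obtain ⟨a, b, ha, hb, hab, hc⟩ := ih (fun y hy => hu y (by simp [hy])) hred'
    have hne' : (u ++ [s]).head? ≠ some x := by
      intro h
      obtain ⟨w, hw⟩ : ∃ w, u ++ [s] = x :: w := by
        cases hu' : u ++ [s] with
        | nil => simp at hu'
        | cons y w =>
          rw [hu'] at h
          simp at h
          exact ⟨w, by rw [h]⟩
      rw [List.cons_append, hw] at hred
      exact not_red_ss A hA _ _ hred
    rw [pw_cons_apply, hab]
    rcases hc with ⟨h1, h3⟩ | ⟨h1, h3⟩
    · have hxt : x = t := by
        rcases hx with rfl | rfl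
        · exact absurd h1 hne'
        · rfl
      subst hxt
      refine ⟨a, -b - A x s * a, ha, ?_, ?_, Or.inr ⟨by simp, ?_⟩⟩
      · nlinarith
      · simp only [sigmaE_apply, map_add, map_smul, rho_sroot, hA, smul_eq_mul]
        module
      · nlinarith
    · have hxt : x = s := by
        rcases hx with rfl | rfl
        · rfl
        · exact absurd h1 hne'
      subst hxt
      refine ⟨-a - A x t * b, b, ?_, hb, ?_, Or.inl ⟨by simp, ?_⟩⟩
      · nlinarith
      · simp only [sigmaE_apply, map_add, map_smul, rho_sroot, hA, smul_eq_mul]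
        module
      · nlinarith

theorem rank_two (s t : Fin n) (hne : s ≠ t) (hst : A s t = A t s) (hneg : A s t ≤ 0)
    (u : List (Fin n)) (hu : ∀ x ∈ u, x = s ∨ x = t)
    (hred : Red A hA (u ++ [s])) :
    ∃ a b : ℤ, 0 ≤ a ∧ 0 ≤ b ∧ pw A hA u (sroot s) = a • sroot s + b • sroot t := by
  by_cases h2 : A s t ≤ -2
  · obtain ⟨a, b, ha, hb, hab, _⟩ := rank_two_big A hA s t hne hst h2 u hu hred
    exact ⟨a, b, ha, hb, hab⟩
  · rcases rank_two_small A hA s t hst (by omega) u hu hred with h | h | ⟨hm, h⟩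
    · subst h
      exact ⟨1, 0, by simp [pw_nil_apply]⟩
    · subst h
      refine ⟨1, - A t s, by simp, by omega, ?_⟩
      simp only [pw_cons_apply, pw_nil_apply, sigmaE_apply, rho_sroot]
      module
    · subst h
      refine ⟨0, 1, by simp, by simp, ?_⟩
      simp only [pw_cons_apply, pw_nil_apply, sigmaE_apply, rho_sroot, map_sub, map_smul, hA,
        ← hst, hm, smul_eq_mul]
      module

theorem tits (hsym : ∀ i j, A i j = A j i) (hneg : ∀ i j, i ≠ j → A i j ≤ 0) :
    ∀ (N : ℕ) (ys : List (Fin n)) (s : Fin n), ys.length = N → Red A hA (ys ++ [s]) →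
      0 ≤ pw A hA ys (sroot s) := by
  intro N
  induction N using Nat.strong_induction_on with
  | _ N IH =>
  intro ys s hN hred
  rcases List.eq_nil_or_concat ys with rfl | ⟨ys', t, hys⟩
  · simpa [pw_nil_apply] using sroot_nonneg s
  · rw [List.concat_eq_append] at hys
    have hredy : Red A hA ys := Red.left A hA hred
    have hst : s ≠ t := by
      rintro rfl
      rw [hys, List.append_assoc] at hred
      exact not_red_ss A hA s [] (Red.right A hA hred)
    let Q : ℕ → Prop := fun m => ∃ v u : List (Fin n), pw A hA (v ++ u) = pw A hA ys ∧
      v.length + u.length = ys.length ∧ (∀ x ∈ u, x = s ∨ x = t) ∧ u.length = m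
    have hQ1 : Q 1 := ⟨ys', [t], by rw [hys], by rw [hys]; simp, by simp, rfl⟩
    have hlen : 1 ≤ ys.length := by rw [hys]; simp
    classical
    obtain ⟨m, hm1, hmQ, hmax⟩ : ∃ m, 1 ≤ m ∧ Q m ∧ ∀ m', m < m' → ¬ Q m' := by
      refine ⟨Nat.findGreatest Q ys.length, Nat.le_findGreatest hlen hQ1,
        Nat.findGreatest_spec hlen hQ1, ?_⟩
      intro m' hm' hq
      have hle : m' ≤ ys.length := by
        obtain ⟨v, u, _, h2, _, h4⟩ := hq
        omega
      exact Nat.findGreatest_is_greatest hm' hle hq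
    obtain ⟨v, u, h1, h2, h3, h4⟩ := hmQ
    have hvu : Red A hA (v ++ (u ++ [s])) := by
      apply Red.congr A hA hred
      · rw [pw_append, ← List.append_assoc, pw_append, h1]
      · simp; omega
    have key : ∀ r, r = s ∨ r = t → 0 ≤ pw A hA v (sroot r) := by
      intro r hr
      apply IH v.length (by omega) v r rfl
      by_contra hcon
      obtain ⟨v', hv1, hv2⟩ := not_red_append A hA hcon
      have e1 : pw A hA (v' ++ r :: u) = pw A hA ys := by
        rw [← h1, pw_append _ _ v, ← hv1, List.append_cons, pw_append _ _ (v' ++ [r])]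
      have e2 := hredy _ e1
      simp at e2
      apply hmax (m + 1) (by omega)
      refine ⟨v', r :: u, e1, ?_, ?_, by simp [h4]⟩
      · simp; omega
      · intro x hx
        rcases List.mem_cons.1 hx with rfl | hx
        · exact hr
        · exact h3 x hx
    obtain ⟨a, b, ha, hb, hab⟩ := rank_two A hA s t hst (hsym s t) (hneg s t hst) u h3
      (Red.right A hA hvu)
    rw [← h1, pw_append_apply, hab, map_add, map_smul, map_smul]
    exact add_nonneg (smul_nonneg ha (key s (Or.inl rfl))) (smul_nonneg hb (key t (Or.inr rfl)))

theorem red_iff_nonneg (hsym : ∀ i j, A i j = A j i) (hneg : ∀ i j, i ≠ j → A i j ≤ 0)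
    {ys : List (Fin n)} {s : Fin n} (h : Red A hA ys) :
    Red A hA (ys ++ [s]) ↔ 0 ≤ pw A hA ys (sroot s) := by
  constructor
  · exact tits A hA hsym hneg _ ys s rfl
  · intro h0
    by_contra hcon
    obtain ⟨v', h1, h2⟩ := not_red_append A hA hcon
    have hr : Red A hA (v' ++ [s]) := Red.congr A hA h h1.symm (by simpa using h2)
    have h3 := tits A hA hsym hneg _ v' s rfl hr
    rw [← h1, pw_append_apply, pw_cons_apply, pw_nil_apply, sigmaE_sroot_self, map_neg] at h0
    have h4 : pw A hA v' (sroot s) = 0 := le_antisymm (by simpa using h0) h3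
    have : sroot s = 0 := by simpa using h4
    exact sroot_ne_zero s this

theorem sign_coherent (hsym : ∀ i j, A i j = A j i) (hneg : ∀ i j, i ≠ j → A i j ≤ 0)
    (ys : List (Fin n)) (s : Fin n) :
    0 ≤ pw A hA ys (sroot s) ∨ pw A hA ys (sroot s) ≤ 0 := by
  obtain ⟨zs, h1, h2⟩ := wordLen_exists A hA ys
  have hz : Red A hA zs := by
    rw [red_iff, ← h2, h1]
  rw [h2]
  by_cases h : Red A hA (zs ++ [s])
  · exact Or.inl (tits A hA hsym hneg _ zs s rfl h)
  · right
    obtain ⟨v', h3, h4⟩ := not_red_append A hA h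
    have hr : Red A hA (v' ++ [s]) := Red.congr A hA hz h3.symm (by simpa using h4)
    have h5 := tits A hA hsym hneg _ v' s rfl hr
    rw [← h3, pw_append_apply, pw_cons_apply, pw_nil_apply, sigmaE_sroot_self, map_neg]
    simpa using h5

/-- Prefix criterion for reducedness. -/
theorem red_iff_splits (hsym : ∀ i j, A i j = A j i) (hneg : ∀ i j, i ≠ j → A i j ≤ 0)
    (S : List (Fin n)) :
    Red A hA S ↔ ∀ P x Q, S = P ++ x :: Q → 0 ≤ pw A hA P (sroot x) := by
  constructor
  · rintro h P x Q rfl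
    rw [List.append_cons] at h
    exact tits A hA hsym hneg _ P x rfl (Red.left A hA h)
  · intro h
    induction S using List.reverseRecOn with
    | nil => exact red_nil A hA
    | append_singleton S s ih =>
      have hS : Red A hA S := ih (by
        rintro P x Q rfl
        exact h P x (Q ++ [s]) (by simp))
      exact (red_iff_nonneg A hA hsym hneg hS).2 (h S s [] rfl)

end Tits
end KP

namespace KP
set_option linter.unusedSimpArgs false

section Comb
variable {n : ℕ}

theorem edges_symm (Λ : Fin n → Fin n → ℕ) (a b : Fin n) : edges Λ a b = edges Λ b a := by
  simp [edges, add_comm]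

theorem edges_flip (x : Fin n) (Λ : Fin n → Fin n → ℕ) : edges (flipO x Λ) = edges Λ := by
  funext a b
  simp only [edges, flipO]
  split_ifs <;> first | omega | tauto

theorem cartan_flip (x : Fin n) (Λ : Fin n → Fin n → ℕ) : cartanOf (flipO x Λ) = cartanOf Λ := by
  funext a b
  simp only [cartanOf, edges_flip]

theorem cartan_symm (Λ : Fin n → Fin n → ℕ) (a b : Fin n) : cartanOf Λ a b = cartanOf Λ b a := by
  simp only [cartanOf, edges_symm Λ a b, eq_comm]

theorem cartan_neg (Λ : Fin n → Fin n → ℕ) (a b : Fin n) (h : a ≠ b) : cartanOf Λ a b ≤ 0 := by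
  simp [cartanOf, h]

theorem cartan_ne (Λ : Fin n → Fin n → ℕ) {a b : Fin n} (h : a ≠ b) :
    cartanOf Λ a b = - (edges Λ a b : ℤ) := by
  simp [cartanOf, h]

theorem flip_comm (a b : Fin n) (Λ : Fin n → Fin n → ℕ) :
    flipO a (flipO b Λ) = flipO b (flipO a Λ) := by
  funext c d
  simp only [flipO]
  split_ifs <;> first | rfl | tauto

theorem flip_flip (a : Fin n) (Λ : Fin n → Fin n → ℕ) : flipO a (flipO a Λ) = Λ := by
  funext c d
  simp only [flipO]
  split_ifs <;> first | rfl | tauto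

theorem sink_flip {Λ : Fin n → Fin n → ℕ} {a b : Fin n} (hab : a ≠ b) (hE : edges Λ a b = 0)
    (h : IsSink Λ a) : IsSink (flipO b Λ) a := by
  intro y
  have h1 := h y
  simp only [edges] at hE
  simp only [flipO]
  split_ifs with h2
  · rcases h2 with h2 | h2
    · exact absurd h2 hab
    · subst h2; omega
  · exact h1

theorem orientAfter_append (Λ : Fin n → Fin n → ℕ) (P Q : List (Fin n)) :
    orientAfter Λ (P ++ Q) = orientAfter (orientAfter Λ P) Q := by
  induction P generalizing Λ with
  | nil => rfl
  | cons x P ih => exact ih _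

theorem admissible_append (Λ : Fin n → Fin n → ℕ) (P Q : List (Fin n)) :
    Admissible Λ (P ++ Q) ↔ Admissible Λ P ∧ Admissible (orientAfter Λ P) Q := by
  induction P generalizing Λ with
  | nil => simp [Admissible, orientAfter]
  | cons x P ih => simp [Admissible, orientAfter, ih, and_assoc]

theorem edges_orientAfter (Λ : Fin n → Fin n → ℕ) (P : List (Fin n)) :
    edges (orientAfter Λ P) = edges Λ := by
  induction P generalizing Λ with
  | nil => rfl
  | cons x P ih => rw [orientAfter, ih, edges_flip]

theorem cartan_orientAfter (Λ : Fin n → Fin n → ℕ) (P : List (Fin n)) :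
    cartanOf (orientAfter Λ P) = cartanOf Λ := by
  funext a b
  simp only [cartanOf, edges_orientAfter]

theorem loop_flip {Λ : Fin n → Fin n → ℕ} (h : ∀ a, Λ a a = 0) (x : Fin n) :
    ∀ a, flipO x Λ a a = 0 := by
  intro a; simp [flipO, h]

theorem loop_orientAfter {Λ : Fin n → Fin n → ℕ} (h : ∀ a, Λ a a = 0) (P : List (Fin n)) :
    ∀ a, orientAfter Λ P a a = 0 := by
  induction P generalizing Λ with
  | nil => exact h
  | cons x P ih => exact ih (loop_flip h x)

theorem swap_symm {E : Fin n → Fin n → ℕ} (hE : ∀ a b, E a b = E b a) {S T : List (Fin n)}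
    (h : SwapRel E S T) : SwapRel E T S := by
  cases h with
  | swap l1 l2 a b hab => exact SwapRel.swap l1 l2 b a (hE a b ▸ hab)

theorem sim_symm {E : Fin n → Fin n → ℕ} (hE : ∀ a b, E a b = E b a) {S T : List (Fin n)}
    (h : Sim E S T) : Sim E T S := by
  induction h with
  | refl => exact Relation.ReflTransGen.refl
  | tail _ h ih => exact Relation.ReflTransGen.head (swap_symm hE h) ih

theorem sim_refl (E : Fin n → Fin n → ℕ) (S : List (Fin n)) : Sim E S S :=
  Relation.ReflTransGen.refl

theorem sim_trans {E : Fin n → Fin n → ℕ} {S T U : List (Fin n)} (h : Sim E S T)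
    (h' : Sim E T U) : Sim E S U := Relation.ReflTransGen.trans h h'

theorem sim_append_left {E : Fin n → Fin n → ℕ} (P : List (Fin n)) {S T : List (Fin n)}
    (h : Sim E S T) : Sim E (P ++ S) (P ++ T) := by
  induction h with
  | refl => exact sim_refl _ _
  | tail _ h ih =>
    refine Relation.ReflTransGen.tail ih ?_
    cases h with
    | swap l1 l2 a b hab =>
      rw [← List.append_assoc, ← List.append_assoc]
      exact SwapRel.swap _ _ _ _ hab

theorem sim_perm {E : Fin n → Fin n → ℕ} {S T : List (Fin n)} (h : Sim E S T) : S.Perm T := by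
  induction h with
  | refl => exact List.Perm.refl _
  | tail _ h ih =>
    refine ih.trans ?_
    cases h with
    | swap l1 l2 a b hab => exact List.Perm.append_left _ (List.Perm.swap _ _ _)

theorem admissible_swap {Λ : Fin n → Fin n → ℕ} {S T : List (Fin n)}
    (h : SwapRel (edges Λ) S T) (hS : Admissible Λ S) : Admissible Λ T := by
  cases h with
  | swap l1 l2 a b hab =>
    rw [admissible_append] at hS ⊢
    refine ⟨hS.1, ?_⟩
    have h2 := hS.2
    rw [← edges_orientAfter Λ l1] at hab
    generalize orientAfter Λ l1 = Λ' at *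
    simp only [Admissible] at h2 ⊢
    obtain ⟨ha, hb, hl⟩ := h2
    by_cases hne : a = b
    · subst hne
      exact ⟨ha, hb, hl⟩
    · refine ⟨?_, sink_flip hne hab ha, flip_comm b a Λ' ▸ hl⟩
      have := sink_flip (b := a) (fun h => hne h.symm) (by rw [edges_flip, edges_symm, hab]) hb
      rwa [flip_flip] at this

theorem admissible_sim {Λ : Fin n → Fin n → ℕ} {S T : List (Fin n)}
    (h : Sim (edges Λ) S T) (hS : Admissible Λ S) : Admissible Λ T := by
  induction h with
  | refl => exact hS
  | tail _ h ih => exact admissible_swap h ih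

theorem sim_to_front {E : Fin n → Fin n → ℕ} (hE : ∀ a b, E a b = E b a) (x : Fin n)
    (P Q : List (Fin n)) (h : ∀ p ∈ P, E x p = 0) : Sim E (P ++ x :: Q) (x :: (P ++ Q)) := by
  induction P with
  | nil => exact sim_refl _ _
  | cons p P ih =>
    have h1 : Sim E (p :: (P ++ x :: Q)) (p :: x :: (P ++ Q)) :=
      sim_append_left [p] (ih fun q hq => h q (by simp [hq]))
    refine sim_trans h1 (Relation.ReflTransGen.single ?_)
    exact SwapRel.swap [] (P ++ Q) p x (hE x p ▸ h p (by simp))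

theorem sim_to_end {E : Fin n → Fin n → ℕ} (x : Fin n)
    (P Q : List (Fin n)) (h : ∀ p ∈ Q, E x p = 0) : Sim E (P ++ x :: Q) (P ++ Q ++ [x]) := by
  induction Q generalizing P with
  | nil => simpa using sim_refl _ _
  | cons q Q ih =>
    have h1 : Sim E (P ++ x :: q :: Q) (P ++ q :: x :: Q) :=
      Relation.ReflTransGen.single (SwapRel.swap _ _ _ _ (h q (by simp)))
    have h2 := ih (P ++ [q]) (fun p hp => h p (by simp [hp]))
    refine sim_trans h1 ?_
    simpa using h2

theorem exists_front {Λ : Fin n → Fin n → ℕ} {S : List (Fin n)} {x : Fin n}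
    (hS : Admissible Λ S) (hx : IsSink Λ x) (hm : x ∈ S) :
    ∃ P Q, S = P ++ x :: Q ∧ ∀ p ∈ P, edges Λ x p = 0 := by
  induction S generalizing Λ with
  | nil => simp at hm
  | cons y S ih =>
    by_cases hxy : x = y
    · subst hxy
      exact ⟨[], S, rfl, by simp⟩
    · have hm' : x ∈ S := by
        rcases List.mem_cons.1 hm with h | h
        · exact absurd h hxy
        · exact h
      have he : edges Λ x y = 0 := by
        simp [edges, hx y, hS.1 x]
      obtain ⟨P, Q, h1, h2⟩ := ih hS.2 (sink_flip hxy he hx) hm'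
      refine ⟨y :: P, Q, by rw [h1]; rfl, ?_⟩
      rw [edges_flip] at h2
      intro p hp
      rcases List.mem_cons.1 hp with rfl | hp
      · exact he
      · exact h2 p hp

theorem exists_complement {Λ : Fin n → Fin n → ℕ} {T S : List (Fin n)}
    (hT : Admissible Λ T) (hS : Admissible Λ S) (hc : ∀ v, T.count v ≤ S.count v) :
    ∃ U, Admissible (orientAfter Λ T) U ∧ Sim (edges Λ) S (T ++ U) := by
  induction T generalizing Λ S with
  | nil => exact ⟨S, hS, sim_refl _ _⟩
  | cons x T ih =>
    have hx : x ∈ S := by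
      rw [← List.count_pos_iff]
      have := hc x
      simp at this
      omega
    obtain ⟨P, Q, h1, h2⟩ := exists_front hS hT.1 hx
    have h3 : Sim (edges Λ) S (x :: (P ++ Q)) := by
      rw [h1]
      exact sim_to_front (edges_symm Λ) x P Q h2
    have h4 := admissible_sim h3 hS
    obtain ⟨U, hU1, hU2⟩ := ih hT.2 h4.2 (by
      intro v
      have h5 := hc v
      rw [(sim_perm h3).count_eq, List.count_cons, List.count_cons] at h5
      omega)
    rw [edges_flip] at hU2
    exact ⟨U, hU1, sim_trans h3 (sim_append_left [x] hU2)⟩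

end Comb

section Occ
variable {n : ℕ} (A : Fin n → Fin n → ℤ) (hA : ∀ i, A i i = 2)

/-- The root attached to the `t`-th occurrence of `v` in `S`. -/
def Occ (S : List (Fin n)) (v : Fin n) (t : ℕ) (β : Fin n → ℤ) : Prop :=
  ∃ P Q, S = P ++ v :: Q ∧ P.count v = t ∧ pw A hA P (sroot v) = β

theorem sigmaE_sroot_comm {a b : Fin n} (h : A b a = 0) : sigmaE A hA b (sroot a) = sroot a := by
  rw [sigmaE_apply, rho_sroot, h, zero_smul, sub_zero]

theorem occ_swap (hsym : ∀ i j, A i j = A j i) {l1 l2 : List (Fin n)} {a b : Fin n}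
    (hab : a ≠ b → A a b = 0) {v : Fin n} {t : ℕ} {β : Fin n → ℤ}
    (h : Occ A hA (l1 ++ a :: b :: l2) v t β) : Occ A hA (l1 ++ b :: a :: l2) v t β := by
  by_cases hne : a = b
  · subst hne; exact h
  have hab' := hab hne
  have hba := hab'
  rw [hsym] at hba
  obtain ⟨P, Q, h1, h2, h3⟩ := h
  have caseA : v = a → P = l1 → Occ A hA (l1 ++ b :: a :: l2) v t β := by
    rintro rfl rfl
    refine ⟨P ++ [b], l2, by simp, ?_, ?_⟩
    · rw [List.count_append, h2]; simp [List.count_cons, Ne.symm hne]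
    · rw [pw_append_apply, pw_cons_apply, pw_nil_apply, sigmaE_sroot_comm A hA hba, h3]
  rcases List.append_eq_append_iff.1 h1 with ⟨c, hc1, hc2⟩ | ⟨c, hc1, hc2⟩
  · rcases c with _ | ⟨c1, _ | ⟨c2, c⟩⟩
    · simp at hc1 hc2
      exact caseA hc2.1.symm hc1
    · simp at hc2
      obtain ⟨rfl, rfl, rfl⟩ := hc2
      subst hc1
      refine ⟨l1, a :: l2, rfl, ?_, ?_⟩
      · rw [← h2, List.count_append]; simp [List.count_cons, hne]
      · rw [← h3, pw_append_apply, pw_cons_apply, pw_nil_apply, sigmaE_sroot_comm A hA hab']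
    · simp at hc2
      obtain ⟨rfl, rfl, rfl⟩ := hc2
      subst hc1
      refine ⟨l1 ++ b :: a :: c, Q, by simp, ?_, ?_⟩
      · rw [← h2]
        exact List.Perm.count_eq (List.Perm.append_left _ (List.Perm.swap _ _ _)) _
      · rw [← h3]
        simp only [pw_append_apply, pw_cons_apply]
        rw [sigmaE_comm A hA b a hba hab']
  · rcases c with _ | ⟨c1, c⟩
    · simp at hc1 hc2
      exact caseA hc2.1 hc1.symm
    · simp at hc2
      obtain ⟨rfl, rfl⟩ := hc2
      subst hc1
      exact ⟨P, c ++ b :: a :: l2, by simp, h2, h3⟩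

theorem cartan_zero_of_edges {Λ : Fin n → Fin n → ℕ} {a b : Fin n} (h : edges Λ a b = 0)
    (hne : a ≠ b) : cartanOf Λ a b = 0 := by
  simp [cartanOf, hne, h]

theorem occ_sim {Λ : Fin n → Fin n → ℕ} {S T : List (Fin n)} (h : Sim (edges Λ) S T)
    {v : Fin n} {t : ℕ} {β : Fin n → ℤ} (hS : Occ (cartanOf Λ) (cartan_diag Λ) S v t β) :
    Occ (cartanOf Λ) (cartan_diag Λ) T v t β := by
  induction h with
  | refl => exact hS
  | tail _ h ih =>
    cases h with
    | swap l1 l2 a b hab =>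
      exact occ_swap _ _ (cartan_symm Λ) (cartan_zero_of_edges hab) ih

theorem occ_append {S U : List (Fin n)} {v : Fin n} {t : ℕ} {β : Fin n → ℤ}
    (h : Occ A hA S v t β) : Occ A hA (S ++ U) v t β := by
  obtain ⟨P, Q, rfl, h2, h3⟩ := h
  exact ⟨P, Q ++ U, by simp, h2, h3⟩

theorem occ_unique {S : List (Fin n)} {v : Fin n} {t : ℕ} {β β' : Fin n → ℤ}
    (h : Occ A hA S v t β) (h' : Occ A hA S v t β') : β = β' := by
  obtain ⟨P, Q, rfl, h2, h3⟩ := h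
  obtain ⟨P', Q', h1', h2', h3'⟩ := h'
  have : P = P' := by
    rcases List.append_eq_append_iff.1 h1' with ⟨c, hc1, hc2⟩ | ⟨c, hc1, hc2⟩
    · rcases c with _ | ⟨c1, c⟩
      · simpa using hc1.symm
      · simp at hc2
        subst hc1
        rw [List.count_append, hc2.1.symm] at h2'
        simp at h2'
        omega
    · rcases c with _ | ⟨c1, c⟩
      · simpa using hc1
      · simp at hc2
        subst hc1
        rw [List.count_append, hc2.1.symm] at h2
        simp at h2
        omega
  rw [← h3, ← h3', this]

theorem occ_exists (S : List (Fin n)) (v : Fin n) (t : ℕ) (h : t < S.count v) :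
    ∃ β, Occ A hA S v t β := by
  suffices ∃ P Q, S = P ++ v :: Q ∧ P.count v = t by
    obtain ⟨P, Q, h1, h2⟩ := this
    exact ⟨_, P, Q, h1, h2, rfl⟩
  induction S generalizing t with
  | nil => simp at h
  | cons x S ih =>
    by_cases hx : x = v
    · subst hx
      rcases t with _ | t
      · exact ⟨[], S, rfl, by simp⟩
      · obtain ⟨P, Q, h1, h2⟩ := ih t (by simpa using h)
        exact ⟨x :: P, Q, by simp [h1], by simp [h2]⟩
    · obtain ⟨P, Q, h1, h2⟩ := ih t (by simpa [List.count_cons, hx] using h)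
      exact ⟨x :: P, Q, by simp [h1], by simp [List.count_cons, hx, h2]⟩

theorem occ_lt {S : List (Fin n)} {v : Fin n} {t : ℕ} {β : Fin n → ℤ}
    (h : Occ A hA S v t β) : t < S.count v := by
  obtain ⟨P, Q, rfl, h2, h3⟩ := h
  simp [h2]

/-- Reducedness for the Cartan matrix of a graph. -/
abbrev CRed (Λ : Fin n → Fin n → ℕ) (S : List (Fin n)) : Prop :=
  Red (cartanOf Λ) (cartan_diag Λ) S

theorem reduced_iff_red (Λ : Fin n → Fin n → ℕ) (S : List (Fin n)) :
    IsReducedSeq Λ S ↔ CRed Λ S := by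
  have h1 : IsReducedSeq Λ S ↔ CRed Λ S.reverse := by
    rw [CRed, red_iff, List.length_reverse]
    rfl
  rw [h1]
  constructor
  · intro h
    have := Red.reverse _ _ h
    rwa [List.reverse_reverse] at this
  · exact Red.reverse _ _

theorem cred_iff_occ (Λ : Fin n → Fin n → ℕ) (S : List (Fin n)) :
    CRed Λ S ↔ ∀ v t β, Occ (cartanOf Λ) (cartan_diag Λ) S v t β → 0 ≤ β := by
  rw [CRed, red_iff_splits _ _ (cartan_symm Λ) (cartan_neg Λ)]
  constructor
  · rintro h v t β ⟨P, Q, h1, h2, rfl⟩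
    exact h P v Q h1
  · intro h P x Q h1
    exact h x _ _ ⟨P, Q, h1, rfl, rfl⟩

theorem cred_sim {Λ : Fin n → Fin n → ℕ} {S T : List (Fin n)} (h : Sim (edges Λ) S T)
    (hS : CRed Λ S) : CRed Λ T := by
  rw [cred_iff_occ] at hS ⊢
  intro v t β ho
  exact hS v t β (occ_sim (sim_symm (edges_symm Λ) h) ho)

theorem occ_of_count_le {Λ : Fin n → Fin n → ℕ} {T S : List (Fin n)}
    (hT : Admissible Λ T) (hS : Admissible Λ S) (hc : ∀ v, T.count v ≤ S.count v)
    {v : Fin n} {t : ℕ} {β : Fin n → ℤ} (ho : Occ (cartanOf Λ) (cartan_diag Λ) T v t β) :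
    Occ (cartanOf Λ) (cartan_diag Λ) S v t β := by
  obtain ⟨U, _, hU⟩ := exists_complement hT hS hc
  exact occ_sim (sim_symm (edges_symm Λ) hU) (occ_append _ _ ho)

theorem segs_count (segs : List (List (Fin n))) (h1 : ∀ seg ∈ segs, seg.Nodup)
    (h2 : ∀ i, i < segs.length → suppOf (segs.getD i []) = suppOf ((segs.drop i).flatten))
    (v : Fin n) (i : ℕ) : v ∈ segs.getD i [] ↔ i < segs.flatten.count v := by
  induction segs generalizing i with
  | nil => simp
  | cons s segs ih =>
    have ih' := ih (fun seg hs => h1 seg (by simp [hs])) (fun i hi => by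
      have := h2 (i + 1) (by simpa using hi)
      simpa using this)
    have h0 := h2 0 (by simp)
    have h0' : v ∈ s ↔ v ∈ s ++ segs.flatten := by
      have := congrArg (fun X => v ∈ X) h0
      simpa [suppOf] using this
    rw [List.flatten_cons, List.count_append]
    by_cases hv : v ∈ s
    · rw [List.count_eq_one_of_mem (h1 s (by simp)) hv]
      rcases i with _ | i
      · simp [hv]
      · rw [List.getD_cons_succ, ih']
        omega
    · have hv' : v ∉ segs.flatten := fun h => hv (h0'.2 (List.mem_append_right _ h))
      have e1 : segs.flatten.count v = 0 := List.count_eq_zero.2 hv'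
      rw [List.count_eq_zero.2 hv, e1]
      rcases i with _ | i
      · simp [hv]
      · rw [List.getD_cons_succ, ih', e1]
        omega

theorem segments_mem {Λ : Fin n → Fin n → ℕ} {S : List (Fin n)} {C : List (List (Fin n))}
    (h : Segments Λ S C) (v : Fin n) (i : ℕ) : v ∈ C.getD i [] ↔ i < S.count v := by
  rw [segs_count C (fun s hs => (h.2.2.1 s hs).2) h.2.2.2, (sim_perm h.2.1).count_eq]

theorem segments_adm {Λ : Fin n → Fin n → ℕ} {S : List (Fin n)} {C : List (List (Fin n))}
    (h : Segments Λ S C) : Admissible Λ S :=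
  admissible_sim (sim_symm (edges_symm Λ) h.2.1) h.1

theorem cred_join {Λ : Fin n → Fin n → ℕ} {T J S : List (Fin n)} (h : IsJoin Λ T J S) :
    CRed Λ S ↔ CRed Λ T ∧ CRed Λ J := by
  obtain ⟨CT, CJ, CS, hT, hJ, hS, hsup⟩ := h
  have key : ∀ v i, i < S.count v ↔ i < T.count v ∨ i < J.count v := by
    intro v i
    rw [← segments_mem hS, ← segments_mem hT, ← segments_mem hJ]
    have := congrArg (fun X => v ∈ X) (hsup i)
    simpa [suppOf] using this
  have hTS : ∀ v, T.count v ≤ S.count v := by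
    intro v
    by_contra hc
    have := (key v (S.count v)).2 (Or.inl (by omega))
    omega
  have hJS : ∀ v, J.count v ≤ S.count v := by
    intro v
    by_contra hc
    have := (key v (S.count v)).2 (Or.inr (by omega))
    omega
  have aT := segments_adm hT
  have aJ := segments_adm hJ
  have aS := segments_adm hS
  simp only [cred_iff_occ]
  constructor
  · intro h
    exact ⟨fun v t β ho => h v t β (occ_of_count_le aT aS hTS ho),
      fun v t β ho => h v t β (occ_of_count_le aJ aS hJS ho)⟩
  · rintro ⟨h1, h2⟩ v t β ho
    rcases (key v t).1 (occ_lt _ _ ho) with hc | hc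
    · obtain ⟨β', ho'⟩ := occ_exists (cartanOf Λ) (cartan_diag Λ) T v t hc
      rw [occ_unique _ _ ho (occ_of_count_le aT aS hTS ho')]
      exact h1 v t β' ho'
    · obtain ⟨β', ho'⟩ := occ_exists (cartanOf Λ) (cartan_diag Λ) J v t hc
      rw [occ_unique _ _ ho (occ_of_count_le aJ aS hJS ho')]
      exact h2 v t β' ho'

theorem cred_joinList {Λ : Fin n → Fin n → ℕ} {Ts : List (List (Fin n))} {S : List (Fin n)}
    (h : IsJoinList Λ Ts S) : CRed Λ S ↔ ∀ T ∈ Ts, CRed Λ T := by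
  induction Ts generalizing S with
  | nil =>
    have : S = [] := h
    subst this
    simpa using red_nil _ _
  | cons T Ts ih =>
    obtain ⟨J, hJ, hJS⟩ := h
    rw [cred_join hJS, ih hJ]
    simp

end Occ
end KP

namespace KP
set_option linter.unusedSimpArgs false

section VMax
variable {n : ℕ} (A : Fin n → Fin n → ℤ) (hA : ∀ i, A i i = 2)

/-- `x` is isolated from the letters of `xs`. -/
def Isol (x : Fin n) (xs : List (Fin n)) : Prop := ∀ y ∈ xs, A x y = 0

open Classical in
/-- The dimension vector of the largest module annihilated by `S`. -/
noncomputable def vmax : List (Fin n) → (Fin n → ℤ)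
  | [] => 0
  | x :: xs => sigmaE A hA x (vmax xs) + (if Isol A x xs then (1 : ℤ) else 0) • sroot x

theorem isol_not_mem (hA : ∀ i, A i i = 2) {x : Fin n} {xs : List (Fin n)} (h : Isol A x xs) : x ∉ xs := fun hx => by
  have := h x hx
  rw [hA] at this
  omega

theorem pw_isol (hsym : ∀ i j, A i j = A j i) {x : Fin n} {xs : List (Fin n)} (h : Isol A x xs) :
    pw A hA xs (sroot x) = sroot x := by
  induction xs with
  | nil => rfl
  | cons y ys ih =>
    rw [pw_cons_apply, ih (fun z hz => h z (List.mem_cons_of_mem _ hz)), sigmaE_sroot_comm]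
    rw [hsym]
    exact h y List.mem_cons_self

theorem isol_reverse {x : Fin n} {xs : List (Fin n)} (h : Isol A x xs) : Isol A x xs.reverse :=
  fun y hy => h y (List.mem_reverse.1 hy)

theorem pw_rev_cons (x : Fin n) (xs : List (Fin n)) (v : Fin n → ℤ) :
    pw A hA (x :: xs).reverse v = pw A hA xs.reverse (sigmaE A hA x v) := by
  rw [List.reverse_cons, pw_append_apply]
  rfl

theorem vmax_supp {U : List (Fin n)} {z : Fin n} (h : z ∉ U) : vmax A hA U z = 0 := by
  induction U with
  | nil => rfl
  | cons x xs ih =>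
    have h1 : z ≠ x := fun e => h (by simp [e])
    have h2 : z ∉ xs := fun e => h (by simp [e])
    rw [vmax, Pi.add_apply, Pi.smul_apply, sigmaE_of_ne A hA x _ h1, ih h2, sroot_of_ne h1]
    simp

theorem vmax_append (hsym : ∀ i j, A i j = A j i) (P U : List (Fin n)) {z : Fin n} (hz : z ∈ U) :
    pw A hA P.reverse (vmax A hA (P ++ U)) z = vmax A hA U z := by
  induction P with
  | nil => rfl
  | cons x xs ih =>
    rw [pw_rev_cons, List.cons_append, vmax, map_add, sigmaE_sigmaE, map_smul, sigmaE_sroot_self,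
      map_add, Pi.add_apply, ih]
    split_ifs with h
    · have h1 : Isol A x xs := fun y hy => h y (List.mem_append_left _ hy)
      have h2 : Isol A x U := fun y hy => h y (List.mem_append_right _ hy)
      have h3 : z ≠ x := fun e => isol_not_mem A hA h2 (e ▸ hz)
      rw [one_smul, map_neg, pw_isol A hA hsym (isol_reverse A h1)]
      simp [sroot_of_ne h3]
    · simp

theorem vmax_word (hsym : ∀ i j, A i j = A j i) (U : List (Fin n)) :
    pw A hA U.reverse (vmax A hA U) ≤ 0 ∧
      (U ≠ [] → pw A hA U.reverse (vmax A hA U) ≠ 0) := by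
  induction U with
  | nil => simp [vmax]
  | cons x xs ih =>
    have key : ∃ ε : ℤ, 0 ≤ ε ∧ (xs = [] → ε = 1) ∧ pw A hA (x :: xs).reverse (vmax A hA (x :: xs)) =
        pw A hA xs.reverse (vmax A hA xs) - ε • sroot x := by
      rw [pw_rev_cons, vmax, map_add, sigmaE_sigmaE, map_smul, sigmaE_sroot_self, map_add]
      split_ifs with h
      · refine ⟨1, by norm_num, fun _ => rfl, ?_⟩
        rw [one_smul, one_smul, map_neg, pw_isol A hA hsym (isol_reverse A h)]
        abel
      · refine ⟨0, le_rfl, fun e => absurd ?_ h, by simp⟩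
        intro y hy
        simp [e] at hy
    obtain ⟨ε, h1, h2, h3⟩ := key
    rw [h3]
    have hpos : ∀ z, 0 ≤ ε * sroot x z := fun z => mul_nonneg h1 (sroot_nonneg x z)
    constructor
    · intro z
      have a1 := ih.1 z
      have a2 := hpos z
      simp only [Pi.sub_apply, Pi.smul_apply, smul_eq_mul, Pi.zero_apply] at a1 a2 ⊢
      omega
    · intro _ h0
      by_cases he : xs = []
      · subst he
        have := congrFun h0 x
        simp [vmax, h2 rfl, sroot_self, pw_nil_apply] at this
      · apply ih.2 he
        funext z
        have a1 := ih.1 z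
        have a2 := hpos z
        have a3 := congrFun h0 z
        simp only [Pi.sub_apply, Pi.smul_apply, smul_eq_mul, Pi.zero_apply] at a1 a2 a3 ⊢
        omega

theorem vmax_ne_zero (hsym : ∀ i j, A i j = A j i) {U : List (Fin n)} (h : U ≠ []) :
    vmax A hA U ≠ 0 := by
  intro h0
  apply (vmax_word A hA hsym U).2 h
  rw [h0, map_zero]

theorem isol_perm {x : Fin n} {xs ys : List (Fin n)} (h : xs.Perm ys) : Isol A x xs ↔ Isol A x ys := by
  constructor
  · exact fun h1 y hy => h1 y (h.mem_iff.2 hy)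
  · exact fun h1 y hy => h1 y (h.mem_iff.1 hy)

open Classical in
theorem vmax_swap (hsym : ∀ i j, A i j = A j i) (l1 l2 : List (Fin n)) {a b : Fin n}
    (hab : a ≠ b → A a b = 0) :
    vmax A hA (l1 ++ a :: b :: l2) = vmax A hA (l1 ++ b :: a :: l2) := by
  by_cases hne : a = b
  · rw [hne]
  have h1 := hab hne
  have h2 : A b a = 0 := by rw [hsym, h1]
  induction l1 with
  | nil =>
    have e1 : Isol A a (b :: l2) ↔ Isol A a l2 := by simp [Isol, h1]
    have e2 : Isol A b (a :: l2) ↔ Isol A b l2 := by simp [Isol, h2]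
    have e1' : (if Isol A a (b :: l2) then (1 : ℤ) else 0) = if Isol A a l2 then 1 else 0 := by
      by_cases h : Isol A a l2
      · rw [if_pos h, if_pos (e1.2 h)]
      · rw [if_neg h, if_neg (fun h' => h (e1.1 h'))]
    have e2' : (if Isol A b (a :: l2) then (1 : ℤ) else 0) = if Isol A b l2 then 1 else 0 := by
      by_cases h : Isol A b l2
      · rw [if_pos h, if_pos (e2.2 h)]
      · rw [if_neg h, if_neg (fun h' => h (e2.1 h'))]
    simp only [List.nil_append, vmax, e1', e2', map_add, map_smul, sigmaE_sroot_comm A hA h1,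
      sigmaE_sroot_comm A hA h2]
    rw [sigmaE_comm A hA a b h1 h2]
    abel
  | cons y ys ih =>
    have e : Isol A y (ys ++ a :: b :: l2) ↔ Isol A y (ys ++ b :: a :: l2) :=
      isol_perm A (List.Perm.append_left _ (List.Perm.swap _ _ _))
    simp only [List.cons_append, vmax, ih]
    by_cases h : Isol A y (ys ++ a :: b :: l2)
    · rw [if_pos h, if_pos (e.1 h)]
    · rw [if_neg h, if_neg (fun h' => h (e.2 h'))]

theorem vmax_sim {Λ : Fin n → Fin n → ℕ} {S T : List (Fin n)} (h : Sim (edges Λ) S T) :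
    vmax (cartanOf Λ) (cartan_diag Λ) S = vmax (cartanOf Λ) (cartan_diag Λ) T := by
  induction h with
  | refl => rfl
  | tail _ h ih =>
    rw [ih]
    cases h with
    | swap l1 l2 a b hab =>
      exact vmax_swap _ _ (cartan_symm Λ) l1 l2 (fun hne => cartan_zero_of_edges hab hne)

/-- If `x :: xs` is reduced then `w(xs) e_x ≥ 0`. -/
theorem red_word_nonneg (hsym : ∀ i j, A i j = A j i) (hneg : ∀ i j, i ≠ j → A i j ≤ 0)
    {x : Fin n} {xs : List (Fin n)} (h : Red A hA (x :: xs)) :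
    0 ≤ pw A hA xs.reverse (sroot x) := by
  have := Red.reverse A hA h
  rw [List.reverse_cons] at this
  exact (red_iff_splits A hA hsym hneg _).1 this xs.reverse x [] rfl

end VMax

section Euler
variable {n : ℕ} (A : Fin n → Fin n → ℤ) (hA : ∀ i, A i i = 2)

/-- The Euler form. -/
def eul (Λ : Fin n → Fin n → ℕ) (a b : Fin n → ℤ) : ℤ :=
  ∑ x, a x * b x - ∑ x, ∑ z, (Λ x z : ℤ) * a x * b z

/-- The part of the Euler form away from `x`. -/
def eulR (x : Fin n) (Λ : Fin n → Fin n → ℕ) (a b : Fin n → ℤ) : ℤ :=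
  ∑ y ∈ Finset.univ.erase x, a y * b y -
    ∑ y ∈ Finset.univ.erase x, ∑ z ∈ Finset.univ.erase x, (Λ y z : ℤ) * a y * b z

theorem eulR_congr {x : Fin n} {Λ Λ' : Fin n → Fin n → ℕ} {a b a' b' : Fin n → ℤ}
    (hΛ : ∀ y z, y ≠ x → z ≠ x → Λ y z = Λ' y z)
    (ha : ∀ y, y ≠ x → a y = a' y) (hb : ∀ y, y ≠ x → b y = b' y) :
    eulR x Λ a b = eulR x Λ' a' b' := by
  unfold eulR
  congr 1
  · refine Finset.sum_congr rfl fun y hy => ?_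
    have := Finset.ne_of_mem_erase hy
    rw [ha y this, hb y this]
  · refine Finset.sum_congr rfl fun y hy => Finset.sum_congr rfl fun z hz => ?_
    have h1 := Finset.ne_of_mem_erase hy
    have h2 := Finset.ne_of_mem_erase hz
    rw [ha y h1, hb z h2, hΛ y z h1 h2]

theorem eul_split (x : Fin n) (Λ : Fin n → Fin n → ℕ) (hl : Λ x x = 0) (a b : Fin n → ℤ) :
    eul Λ a b = eulR x Λ a b + a x * b x - (∑ y, (Λ y x : ℤ) * a y) * b x
      - a x * ∑ y, (Λ x y : ℤ) * b y := by
  unfold eul eulR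
  have h1 : ∑ y, a y * b y = a x * b x + ∑ y ∈ Finset.univ.erase x, a y * b y :=
    (Finset.add_sum_erase _ _ (Finset.mem_univ x)).symm
  have h2 : ∀ y, ∑ z, (Λ y z : ℤ) * a y * b z = (Λ y x : ℤ) * a y * b x +
      ∑ z ∈ Finset.univ.erase x, (Λ y z : ℤ) * a y * b z := fun y =>
    (Finset.add_sum_erase _ _ (Finset.mem_univ x)).symm
  have h3 : ∑ y, ∑ z, (Λ y z : ℤ) * a y * b z = ∑ z, (Λ x z : ℤ) * a x * b z +
      ∑ y ∈ Finset.univ.erase x, ∑ z, (Λ y z : ℤ) * a y * b z :=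
    (Finset.add_sum_erase _ _ (Finset.mem_univ x)).symm
  have h4 : ∑ y, (Λ y x : ℤ) * a y = ∑ y ∈ Finset.univ.erase x, (Λ y x : ℤ) * a y := by
    rw [← Finset.add_sum_erase _ _ (Finset.mem_univ x), hl]; simp
  rw [h1, h3, Finset.sum_congr rfl (fun y _ => h2 y) (s₁ := Finset.univ.erase x),
    Finset.sum_add_distrib, ← Finset.sum_mul, h4]
  have h5 : ∑ z, (Λ x z : ℤ) * a x * b z = a x * ∑ y, (Λ x y : ℤ) * b y := by
    rw [Finset.mul_sum]
    exact Finset.sum_congr rfl fun z _ => by ring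
  rw [h5]
  ring

theorem sigma_sink {x : Fin n} {Λ : Fin n → Fin n → ℕ} (hc : cartanOf Λ = A) (hl : Λ x x = 0)
    (hx : IsSink Λ x) (a : Fin n → ℤ) :
    sigmaE A hA x a x = (∑ y, (Λ y x : ℤ) * a y) - a x := by
  rw [sigmaE_self, rho_apply]
  have : ∀ y, A x y * a y = (if x = y then 2 * a y else 0) - (Λ y x : ℤ) * a y := by
    intro y
    rw [← hc]
    unfold cartanOf edges
    split_ifs with h
    · subst h; simp [hl]
    · simp [hx y]
  rw [Finset.sum_congr rfl fun y _ => this y, Finset.sum_sub_distrib, Finset.sum_ite_eq]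
  simp
  ring

theorem eul_sigma {x : Fin n} {Λ : Fin n → Fin n → ℕ} (hc : cartanOf Λ = A) (hl : Λ x x = 0)
    (hx : IsSink Λ x) (a b : Fin n → ℤ) :
    eul (flipO x Λ) (sigmaE A hA x a) (sigmaE A hA x b) = eul Λ a b := by
  rw [eul_split x _ (by simp [flipO, hl]), eul_split x Λ hl]
  rw [eulR_congr (Λ' := Λ) (a' := a) (b' := b) (fun y z hy hz => by simp [flipO, hy, hz])
    (fun y hy => sigmaE_of_ne A hA x a hy) (fun y hy => sigmaE_of_ne A hA x b hy)]
  have e1 : ∀ y, flipO x Λ y x = 0 := fun y => by simp [flipO, hx y]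
  have e2 : ∀ y, flipO x Λ x y = Λ y x := fun y => by simp [flipO]
  have e3 : ∀ v : Fin n → ℤ, ∑ y, (Λ y x : ℤ) * sigmaE A hA x v y = ∑ y, (Λ y x : ℤ) * v y := by
    intro v
    refine Finset.sum_congr rfl fun y _ => ?_
    by_cases h : y = x
    · subst h; simp [hl]
    · rw [sigmaE_of_ne A hA x v h]
  simp only [e1, e2, e3, hx _, sigma_sink A hA hc hl hx]
  simp
  ring

theorem eul_pw {Λ : Fin n → Fin n → ℕ} (hc : cartanOf Λ = A) (hl : ∀ a, Λ a a = 0)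
    {P : List (Fin n)} (hP : Admissible Λ P) (a b : Fin n → ℤ) :
    eul Λ (pw A hA P a) (pw A hA P b) = eul (orientAfter Λ P) a b := by
  induction P generalizing Λ with
  | nil => rfl
  | cons x xs ih =>
    rw [orientAfter, ← ih (by rw [cartan_flip, hc]) (loop_flip hl x) hP.2, pw_cons_apply,
      pw_cons_apply, ← eul_sigma A hA hc (hl x) hP.1, sigmaE_sigmaE, sigmaE_sigmaE]

theorem eul_sroot_sink {x : Fin n} {Λ : Fin n → Fin n → ℕ} (hx : IsSink Λ x) (b : Fin n → ℤ) :
    eul Λ (sroot x) b = b x := by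
  unfold eul
  have h1 : ∀ y z, (Λ y z : ℤ) * sroot x y * b z = 0 := by
    intro y z
    by_cases h : y = x
    · subst h; simp [hx z]
    · simp [sroot_of_ne h]
  simp only [h1]
  simp [sroot, Pi.single_apply]

theorem eul_sroot_source {y : Fin n} {Λ : Fin n → Fin n → ℕ} (hc : cartanOf Λ = A)
    (hl : Λ y y = 0) (hy : IsSink Λ y) (u : Fin n → ℤ) (c : ℤ) :
    eul (flipO y Λ) (c • sroot y) u = - c * (sigmaE A hA y u y) := by
  rw [sigma_sink A hA hc hl hy]
  unfold eul
  have h1 : ∀ a, ∑ z, (flipO y Λ a z : ℤ) * (c • sroot y) a * u z =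
      if a = y then c * ∑ z, (Λ z y : ℤ) * u z else 0 := by
    intro a
    split_ifs with h
    · subst h
      rw [Finset.mul_sum]
      refine Finset.sum_congr rfl fun z _ => ?_
      simp [flipO, sroot_self]
      ring
    · simp [sroot_of_ne h]
  have h2 : ∑ a, (c • sroot y) a * u a = c * u y := by
    simp [sroot, Pi.single_apply]
  simp only [h1, h2]
  simp
  ring

/-- All suffix roots are nonnegative. -/
def Good (P : List (Fin n)) (x : Fin n) : Prop :=
  ∀ P1 P2, P = P1 ++ P2 → 0 ≤ pw A hA P2 (sroot x)

theorem pw_of_not_mem (Q : List (Fin n)) (v : Fin n → ℤ) {y : Fin n} (hy : y ∉ Q) :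
    pw A hA Q v y = v y := by
  induction Q with
  | nil => rfl
  | cons q Q ih =>
    simp only [List.mem_cons, not_or] at hy
    rw [pw_cons_apply, sigmaE_of_ne A hA q _ hy.1, ih hy.2]

theorem claimB {Λ : Fin n → Fin n → ℕ} (hc : cartanOf Λ = A) (hl : ∀ a, Λ a a = 0)
    {P Q : List (Fin n)} {x z : Fin n} (hadm : Admissible Λ (P ++ x :: Q))
    (hQ : ∀ y ∈ Q, A x y = 0) (hxz : A x z < 0)
    (hg : Good A hA (P ++ x :: Q) z) : Good A hA P x := by
  have hsym : ∀ i j, A i j = A j i := by rw [← hc]; exact cartan_symm Λ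
  have hneg : ∀ i j, i ≠ j → A i j ≤ 0 := by rw [← hc]; exact cartan_neg Λ
  have hzx : x ≠ z := fun e => by rw [e, hA] at hxz; omega
  have hxQ : x ∉ Q := isol_not_mem A hA hQ
  intro P1 P2 hP
  induction P2 generalizing P1 with
  | nil => exact sroot_nonneg x
  | cons y P2 ih =>
    have ih' := ih (P1 ++ [y]) (by simp [hP])
    rcases sign_coherent A hA hsym hneg (y :: P2) x with h | h
    · exact h
    exfalso
    set v := pw A hA P2 (sroot x) with hv
    rw [pw_cons_apply, ← hv] at h
    have hoff : ∀ w, w ≠ y → v w = 0 := fun w hw => by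
      have h1 := h w
      rw [sigmaE_of_ne A hA y v hw] at h1
      exact le_antisymm h1 (ih' w)
    have hve : v = v y • sroot y := by
      funext w
      by_cases hw : w = y
      · subst hw; simp [sroot_self]
      · simp [hoff w hw, sroot_of_ne hw]
    have hv0 : v ≠ 0 := fun e => by
      rw [hv] at e
      exact sroot_ne_zero x ((LinearEquiv.map_eq_zero_iff _).1 e)
    have hc0 : 0 ≤ v y := ih' y
    subst hP
    rw [List.append_assoc, admissible_append, List.cons_append] at hadm
    obtain ⟨_, hy, h3⟩ := hadm
    rw [admissible_append] at h3
    obtain ⟨hP2, hxs, _⟩ := h3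
    have hl1 := loop_orientAfter hl P1
    have hc1 : cartanOf (orientAfter Λ P1) = A := by rw [cartan_orientAfter, hc]
    set Λ1 := orientAfter Λ P1
    have k1 := eul_pw A hA (Λ := flipO y Λ1) (by rw [cartan_flip, hc1]) (loop_flip hl1 y) hP2
      (sroot x) (pw A hA (x :: Q) (sroot z))
    rw [eul_sroot_sink hxs, ← hv, ← pw_append_apply, hve, eul_sroot_source A hA hc1 (hl1 y) hy,
      ← pw_cons_apply] at k1
    have k2 := hg P1 (y :: (P2 ++ x :: Q)) (by simp) y
    have k3 : 0 < pw A hA (x :: Q) (sroot z) x := by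
      rw [pw_cons_apply, sigmaE_self, rho_apply, pw_of_not_mem A hA Q _ hxQ, sroot_of_ne hzx]
      have : ∀ l, A x l * pw A hA Q (sroot z) l = if l = z then A x z else 0 := by
        intro l
        by_cases hlQ : l ∈ Q
        · rw [hQ l hlQ]
          split_ifs with hlz
          · rw [← hlz, hQ l hlQ]; simp
          · simp
        · rw [pw_of_not_mem A hA Q _ hlQ]
          split_ifs with hlz
          · subst hlz; simp [sroot_self]
          · simp [sroot_of_ne hlz]
      simp only [this]
      simp
      omega
    rw [← k1] at k3
    have := mul_nonneg hc0 k2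
    simp only [Pi.zero_apply, neg_mul] at this k3
    linarith

/-- Isolated positions suffice. -/
theorem good_all {Λ : Fin n → Fin n → ℕ} (hc : cartanOf Λ = A) (hl : ∀ a, Λ a a = 0)
    (hnb : ∀ a, ∃ b, edges Λ a b ≠ 0)
    {S : List (Fin n)} (hadm : Admissible Λ S)
    (h : ∀ P x Q, S = P ++ x :: Q → Isol A x Q → Good A hA P x) :
    ∀ (N : ℕ) P x Q, Q.length = N → S = P ++ x :: Q → Good A hA P x := by
  have hneg : ∀ i j, i ≠ j → A i j ≤ 0 := by rw [← hc]; exact cartan_neg Λ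
  intro N
  induction N using Nat.strong_induction_on with
  | _ N ih =>
  intro P x Q hN hS
  by_cases hiso : Isol A x Q
  · exact h P x Q hS hiso
  -- first non-isolated letter
  have key : ∀ Q : List (Fin n), ¬ Isol A x Q → ∃ Q1 z Q2, Q = Q1 ++ z :: Q2 ∧ Isol A x Q1 ∧
      A x z ≠ 0 := by
    intro Q
    induction Q with
    | nil => exact fun h => absurd (fun y hy => by simp at hy) h
    | cons q Q ihQ =>
      intro hq
      by_cases h0 : A x q = 0
      · have : ¬ Isol A x Q := fun h1 => hq (fun y hy => by
          rcases List.mem_cons.1 hy with rfl | hy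
          · exact h0
          · exact h1 y hy)
        obtain ⟨Q1, z, Q2, e1, e2, e3⟩ := ihQ this
        refine ⟨q :: Q1, z, Q2, by simp [e1], fun y hy => ?_, e3⟩
        rcases List.mem_cons.1 hy with rfl | hy
        · exact h0
        · exact e2 y hy
      · exact ⟨[], q, Q, rfl, fun y hy => by simp at hy, h0⟩
  obtain ⟨Q1, z, Q2, e1, e2, e3⟩ := key Q hiso
  subst e1
  have hadm2 : Admissible Λ (P ++ x :: Q1 ++ z :: Q2) := by
    rw [hS] at hadm; simpa using hadm
  have hxz : x ≠ z := by
    rintro rfl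
    rw [admissible_append] at hadm2
    obtain ⟨h1, h2, _⟩ := hadm2
    obtain ⟨b, hb⟩ := hnb x
    rw [admissible_append] at h1
    have hxs := h1.2.1
    rw [orientAfter_append, orientAfter] at h2
    rw [← edges_orientAfter Λ P] at hb
    have hc2 : cartanOf (orientAfter Λ P) = A := by rw [cartan_orientAfter, hc]
    have hl2 := loop_orientAfter hl P x
    generalize orientAfter Λ P = Λ' at *
    have h4 : Λ' b x ≠ 0 := by
      unfold edges at hb
      rw [hxs b] at hb
      omega
    have hbx : b ≠ x := fun e => h4 (by rw [e, hl2])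
    have h5 : b ∉ Q1 := fun hm => by
      have := e2 b hm
      rw [← hc2, cartan_ne _ hbx.symm] at this
      simp at this
      exact hb this
    have h6 : x ∉ Q1 := isol_not_mem A hA e2
    have h7 : ∀ (Q : List (Fin n)) (Λ'' : Fin n → Fin n → ℕ), b ∉ Q → x ∉ Q →
        orientAfter Λ'' Q x b = Λ'' x b := by
      intro Q
      induction Q with
      | nil => intros; rfl
      | cons q Q ihq =>
        intro Λ'' hb1 hx1
        simp only [List.mem_cons, not_or] at hb1 hx1
        rw [orientAfter, ihq _ hb1.2 hx1.2]
        simp [flipO, hb1.1, hx1.1]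
    have := h2 b
    rw [h7 Q1 _ h5 h6] at this
    simp [flipO] at this
    exact h4 this
  have hlt : A x z < 0 := lt_of_le_of_ne (hneg x z hxz) e3
  rw [admissible_append] at hadm2
  refine claimB A hA hc hl hadm2.1 e2 hlt ?_
  refine ih Q2.length ?_ (P ++ x :: Q1) z Q2 rfl (by simp [hS])
  rw [← hN]
  simp
  omega

theorem red_of_isol {Λ : Fin n → Fin n → ℕ} (hl : ∀ a, Λ a a = 0)
    (hnb : ∀ a, ∃ b, edges Λ a b ≠ 0)
    {S : List (Fin n)} (hadm : Admissible Λ S)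
    (h : ∀ P x Q, S = P ++ x :: Q → Isol (cartanOf Λ) x Q →
      Good (cartanOf Λ) (cartan_diag Λ) P x) : CRed Λ S := by
  rw [CRed, red_iff_splits _ _ (cartan_symm Λ) (cartan_neg Λ)]
  intro P x Q hS
  exact good_all _ _ rfl hl hnb hadm h _ P x Q rfl hS [] P rfl

end Euler
end KP

namespace KP
set_option linter.unusedSimpArgs false

section RefApi
variable {k : Type} [Field k] {n : ℕ}

/-- Identification away from the reflected vertex. -/
noncomputable def offE (x : Fin n) (Λ : Fin n → Fin n → ℕ) (M : Rep k n Λ) {z : Fin n} (hz : z ≠ x) :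
    (Fin ((reflPlus x Λ M).d z) → k) ≃ₗ[k] (Fin (M.d z) → k) :=
  castL k (if_neg hz)

/-- Identification at the reflected vertex. -/
noncomputable def onE (x : Fin n) (Λ : Fin n → Fin n → ℕ) (M : Rep k n Λ) :
    (Fin ((reflPlus x Λ M).d x) → k) ≃ₗ[k] LinearMap.ker (inMap Λ M x) :=
  (castL k (if_pos rfl)).trans (kerEquiv Λ M x).symm

theorem castL_castL {a b : ℕ} (h : a = b) (h' : b = a) (v : Fin b → k) :
    castL k h (castL k h' v) = v := by
  subst h; rfl

theorem refl_f_off (x : Fin n) (Λ : Fin n → Fin n → ℕ) (M : Rep k n Λ) {a b : Fin n}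
    (ha : a ≠ x) (hb : b ≠ x) (i : Fin (flipO x Λ a b)) (j : Fin (Λ a b)) (hij : i.val = j.val)
    (v : Fin ((reflPlus x Λ M).d a) → k) :
    offE x Λ M hb ((reflPlus x Λ M).f a b i v) = M.f a b j (offE x Λ M ha v) := by
  have e : (Fin.cast (by simp [flipO, ha, hb]) i : Fin (Λ a b)) = j := Fin.ext hij
  have h1 : (reflPlus x Λ M).f a b i = (offE x Λ M hb).symm.toLinearMap ∘ₗ M.f a b j ∘ₗ
      (offE x Λ M ha).toLinearMap := by
    rw [← e]
    exact (dif_neg ha).trans (dif_neg hb)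
  rw [h1]
  simp

theorem refl_f_on (x : Fin n) (Λ : Fin n → Fin n → ℕ) (M : Rep k n Λ) {b : Fin n}
    (hb : b ≠ x) (i : Fin (flipO x Λ x b)) (j : Fin (Λ b x)) (hij : i.val = j.val)
    (v : Fin ((reflPlus x Λ M).d x) → k) :
    offE x Λ M hb ((reflPlus x Λ M).f x b i v) = (onE x Λ M v).1 ⟨b, j⟩ := by
  have e : (Fin.cast (by simp [flipO]) i : Fin (Λ b x)) = j := Fin.ext hij
  have h1 : (reflPlus x Λ M).f x b i = (offE x Λ M hb).symm.toLinearMap ∘ₗ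
      (LinearMap.proj (φ := fun p : Arin Λ x => Fin (M.d p.1) → k) (⟨b, j⟩ : Arin Λ x)) ∘ₗ
      (LinearMap.ker (inMap Λ M x)).subtype ∘ₗ (onE x Λ M).toLinearMap := by
    rw [← e]
    exact (dif_pos rfl).trans (dif_neg hb)
  rw [h1]
  simp

theorem refl_d_off (x : Fin n) (Λ : Fin n → Fin n → ℕ) (M : Rep k n Λ) {z : Fin n} (hz : z ≠ x) :
    (reflPlus x Λ M).d z = M.d z := if_neg hz

theorem refl_d_on (x : Fin n) (Λ : Fin n → Fin n → ℕ) (M : Rep k n Λ) :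
    (reflPlus x Λ M).d x = Module.finrank k (LinearMap.ker (inMap Λ M x)) := if_pos rfl

theorem inMap_apply (x : Fin n) (Λ : Fin n → Fin n → ℕ) (M : Rep k n Λ)
    (v : (p : Arin Λ x) → (Fin (M.d p.1) → k)) :
    inMap Λ M x v = ∑ p : Arin Λ x, M.f p.1 x p.2 (v p) := by
  simp [inMap, LinearMap.sum_apply]

theorem inMap_single (x : Fin n) (Λ : Fin n → Fin n → ℕ) (M : Rep k n Λ) (p : Arin Λ x)
    (v : Fin (M.d p.1) → k) :
    inMap Λ M x (LinearMap.single k (fun p : Arin Λ x => Fin (M.d p.1) → k) p v) =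
      M.f p.1 x p.2 v := by
  rw [inMap_apply, Finset.sum_eq_single p]
  · simp
  · intro q _ hq
    simp [Pi.single_eq_of_ne hq]
  · simp

/-- Dimension vector. -/
def dimv {Λ : Fin n → Fin n → ℕ} (M : Rep k n Λ) : Fin n → ℤ := fun z => (M.d z : ℤ)

theorem finrank_arin (x : Fin n) (Λ : Fin n → Fin n → ℕ) (d : Fin n → ℕ) :
    Module.finrank k ((p : Arin Λ x) → (Fin (d p.1) → k)) = ∑ y, Λ y x * d y := by
  rw [Module.finrank_pi_fintype, Fintype.sum_sigma]
  simp

variable (A : Fin n → Fin n → ℤ) (hA : ∀ i, A i i = 2)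

theorem dimv_refl {x : Fin n} {Λ : Fin n → Fin n → ℕ} (hc : cartanOf Λ = A)
    (hx : IsSink Λ x) (M : Rep k n Λ) :
    ∃ c : ℤ, 0 ≤ c ∧ dimv (reflPlus x Λ M) = sigmaE A hA x (dimv M) + c • sroot x := by
  have h1 := LinearMap.finrank_range_add_finrank_ker (inMap Λ M x)
  rw [finrank_arin x Λ M.d] at h1
  have h2 : Module.finrank k (LinearMap.range (inMap Λ M x)) ≤ M.d x := by
    have := Submodule.finrank_le (LinearMap.range (inMap Λ M x))
    simpa using this
  refine ⟨(Module.finrank k (LinearMap.ker (inMap Λ M x)) : ℤ) - sigmaE A hA x (dimv M) x, ?_, ?_⟩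
  · rw [sigma_sink A hA hc (hx x) hx]
    have h3 : (∑ y, (Λ y x : ℤ) * dimv M y) = ((∑ y, Λ y x * M.d y : ℕ) : ℤ) := by
      simp [dimv]
    rw [h3]
    simp only [dimv]
    omega
  · funext z
    by_cases hz : z = x
    · subst hz
      simp [dimv, refl_d_on, sroot_self]
    · simp [sroot_of_ne hz, sigmaE_of_ne A hA x _ hz, dimv, refl_d_off x Λ M hz]

theorem ann_nonpos {Λ : Fin n → Fin n → ℕ} (hc : cartanOf Λ = A) {S : List (Fin n)}
    (hS : Admissible Λ S) (hr : Red A hA S) (M : Rep k n Λ) (h : Annihilates Λ S M) :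
    pw A hA S.reverse (dimv M) ≤ 0 := by
  induction S generalizing Λ with
  | nil =>
    intro z
    have : M.d z = 0 := h z
    simp [pw_nil_apply, dimv, this]
  | cons x xs ih =>
    have hsym : ∀ i j, A i j = A j i := by rw [← hc]; exact cartan_symm Λ
    have hneg : ∀ i j, i ≠ j → A i j ≤ 0 := by rw [← hc]; exact cartan_neg Λ
    have h1 := ih (by rw [cartan_flip, hc]) hS.2 (Red.right A hA (xs := [x]) hr)
      (reflPlus x Λ M) h
    obtain ⟨c, hc0, hd⟩ := dimv_refl A hA hc hS.1 M
    rw [hd, map_add, map_smul] at h1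
    rw [pw_rev_cons]
    have h2 := red_word_nonneg A hA hsym hneg hr
    intro z
    have a1 := h1 z
    have a2 := mul_nonneg hc0 (h2 z)
    simp only [Pi.add_apply, Pi.smul_apply, smul_eq_mul, Pi.zero_apply] at a1 a2 ⊢
    linarith

end RefApi

section PM
variable {k : Type} [Field k] {n : ℕ}

/-- Partial monomorphism over a set of vertices. -/
def PMono {Λ Λ' : Fin n → Fin n → ℕ} (D : Fin n → Prop) (M : Rep k n Λ) (N : Rep k n Λ') : Prop :=
  ∃ g : ∀ z, (Fin (M.d z) → k) →ₗ[k] (Fin (N.d z) → k),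
    (∀ z, D z → Function.Injective (g z)) ∧
    ∀ a b, D a → D b → ∀ (i : Fin (Λ a b)) (j : Fin (Λ' a b)), i.val = j.val →
      ∀ v, g b (M.f a b i v) = N.f a b j (g a v)

theorem pmono_d {Λ Λ' : Fin n → Fin n → ℕ} {D : Fin n → Prop} {M : Rep k n Λ} {N : Rep k n Λ'}
    (h : PMono D M N) {z : Fin n} (hz : D z) : M.d z ≤ N.d z := by
  obtain ⟨g, h1, _⟩ := h
  have := LinearMap.finrank_le_finrank_of_injective (h1 z hz)
  simpa using this

theorem pmono_refl {Λ Λ' : Fin n → Fin n → ℕ} {D : Fin n → Prop} {M : Rep k n Λ} {N : Rep k n Λ'}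
    (h : PMono D M N) {q : Fin n} (hq : D q) (hs : IsSink Λ q)
    (hcol : ∀ y, Λ y q = Λ' y q) (hD : ∀ y, Λ y q ≠ 0 → D y) :
    PMono D (reflPlus q Λ M) (reflPlus q Λ' N) := by
  obtain ⟨g, hinj, hcomm⟩ := h
  -- the induced map on the sums
  let G : ((p : Arin Λ q) → (Fin (M.d p.1) → k)) →ₗ[k] ((p : Arin Λ' q) → (Fin (N.d p.1) → k)) :=
    LinearMap.pi fun p => (g p.1) ∘ₗ
      LinearMap.proj (φ := fun p : Arin Λ q => Fin (M.d p.1) → k)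
        (⟨p.1, Fin.cast (hcol p.1).symm p.2⟩ : Arin Λ q)
  have hG : ∀ v (y : Fin n) (j : Fin (Λ' y q)), G v ⟨y, j⟩ = g y (v ⟨y, Fin.cast (hcol y).symm j⟩) :=
    fun v y j => rfl
  have hD' : ∀ y, Fin (Λ y q) → D y := fun y i => hD y (fun e => by rw [e] at i; exact i.elim0)
  have hGk : ∀ v, inMap Λ' N q (G v) = g q (inMap Λ M q v) := by
    intro v
    rw [inMap_apply, inMap_apply, map_sum]
    refine (Fintype.sum_equiv (Equiv.sigmaCongrRight fun y => finCongr (hcol y)) _ _ ?_).symm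
    rintro ⟨y, i⟩
    refine (hcomm y q (hD' y i) hq i (finCongr (hcol y) i) (by simp) _).trans ?_
    rfl
  have hGi : Function.Injective G := by
    intro v w hvw
    funext ⟨y, i⟩
    have := congrFun hvw ⟨y, Fin.cast (hcol y) i⟩
    rw [hG, hG] at this
    exact hinj y (hD' y i) this
  let K : LinearMap.ker (inMap Λ M q) →ₗ[k] LinearMap.ker (inMap Λ' N q) :=
    G.restrict (fun v hv => by
      rw [LinearMap.mem_ker] at hv ⊢
      rw [hGk, hv, map_zero])
  have hKi : Function.Injective K := by
    intro v w hvw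
    apply Subtype.ext
    exact hGi (congrArg Subtype.val hvw)
  let g0 : ∀ z, (Fin ((reflPlus q Λ M).d z) → k) →ₗ[k] (Fin ((reflPlus q Λ' N).d z) → k) :=
    fun z => if hz : z = q then 0
    else (offE q Λ' N hz).symm.toLinearMap ∘ₗ g z ∘ₗ (offE q Λ M hz).toLinearMap
  obtain ⟨g', hgq, hgo⟩ : ∃ g' : ∀ z, (Fin ((reflPlus q Λ M).d z) → k) →ₗ[k]
      (Fin ((reflPlus q Λ' N).d z) → k),
      g' q = (onE q Λ' N).symm.toLinearMap ∘ₗ K ∘ₗ (onE q Λ M).toLinearMap ∧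
        ∀ z, z ≠ q → g' z = g0 z :=
    ⟨Function.update g0 q _, Function.update_self _ _ _, fun z hz => Function.update_of_ne hz _ _⟩
  have hg1 : ∀ v, onE q Λ' N (g' q v) = K (onE q Λ M v) := by
    intro v
    simp [hgq]
  have hg2 : ∀ z (hz : z ≠ q) v, offE q Λ' N hz (g' z v) = g z (offE q Λ M hz v) := by
    intro z hz v
    simp [hgo z hz, g0, hz]
  refine ⟨g', ?_, ?_⟩
  · intro z hz
    by_cases e : z = q
    · subst e
      intro v w hvw
      have := congrArg (onE z Λ' N) hvw
      rw [hg1, hg1] at this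
      exact (onE z Λ M).injective (hKi this)
    · intro v w hvw
      have := congrArg (offE q Λ' N e) hvw
      rw [hg2, hg2] at this
      exact (offE q Λ M e).injective (hinj z hz this)
  · intro a b ha hb i j hij v
    by_cases eb : b = q
    · exfalso
      subst eb
      have h0 : flipO b Λ a b = 0 := by simp [flipO, hs a]
      rw [h0] at i
      exact i.elim0
    apply (offE q Λ' N eb).injective
    rw [hg2 b eb]
    by_cases ea : a = q
    · subst ea
      have e1 : flipO a Λ a b = Λ b a := by simp [flipO]
      have e2 : flipO a Λ' a b = Λ' b a := by simp [flipO]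
      rw [refl_f_on a Λ M eb i (Fin.cast e1 i) rfl, refl_f_on a Λ' N eb j (Fin.cast e2 j) rfl, hg1]
      have hKG : ∀ u, (K u).1 = G u.1 := fun u => rfl
      rw [hKG]
      rw [hG]
      have e3 : Fin.cast e1 i = Fin.cast (hcol b).symm (Fin.cast e2 j) := Fin.ext hij
      rw [e3]
    · have e1 : flipO q Λ a b = Λ a b := by simp [flipO, ea, eb]
      have e2 : flipO q Λ' a b = Λ' a b := by simp [flipO, ea, eb]
      rw [refl_f_off q Λ M ea eb i (Fin.cast e1 i) rfl, refl_f_off q Λ' N ea eb j (Fin.cast e2 j) rfl,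
        hg2 a ea]
      exact hcomm a b ha hb _ _ hij _

/-- Subrepresentations of annihilated representations are annihilated. -/
theorem ann_sub {Λ : Fin n → Fin n → ℕ} {M N : Rep k n Λ} {S : List (Fin n)} (hS : Admissible Λ S)
    (h : PMono (fun _ => True) M N) (hN : Annihilates Λ S N) : Annihilates Λ S M := by
  induction S generalizing Λ with
  | nil =>
    intro z
    have h1 := pmono_d h (z := z) trivial
    have h2 : N.d z = 0 := hN z
    change M.d z = 0
    omega
  | cons x xs ih =>
    exact ih hS.2 (pmono_refl h trivial hS.1 (fun _ => rfl) (fun _ _ => trivial)) hN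

theorem off_step {x : Fin n} {Q : List (Fin n)} (hx : x ∉ Q) :
    ∀ {Λ Λ' : Fin n → Fin n → ℕ} {M : Rep k n Λ} {N : Rep k n Λ'},
    Admissible Λ Q → edges Λ = edges Λ' → (∀ q ∈ Q, edges Λ x q = 0) →
    (∀ a b, a ≠ x → b ≠ x → Λ a b = Λ' a b) →
    PMono (fun z => z ≠ x) M N → PMono (fun z => z ≠ x) (FList Q Λ M) (FList Q Λ' N) := by
  induction Q with
  | nil => intro Λ Λ' M N _ _ _ _ h; exact h
  | cons q Q ih =>
    intro Λ Λ' M N ha he hq hag h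
    simp only [List.mem_cons, not_or] at hx
    have hqx : q ≠ x := fun e => hx.1 e.symm
    have e1 : edges Λ x q = 0 := hq q List.mem_cons_self
    have e2 : edges Λ' x q = 0 := by rw [← he]; exact e1
    unfold edges at e1 e2
    have hcol : ∀ y, Λ y q = Λ' y q := by
      intro y
      by_cases hy : y = x
      · subst hy; omega
      · exact hag y q hy hqx
    refine ih hx.2 ha.2 (by rw [edges_flip, edges_flip, he])
      (fun p hp => by rw [edges_flip]; exact hq p (List.mem_cons_of_mem _ hp)) ?_
      (pmono_refl h hqx ha.1 hcol ?_)
    · intro a b h1 h2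
      simp only [flipO]
      split_ifs
      · exact hag b a h2 h1
      · exact hag a b h1 h2
    · rintro y hy rfl
      exact hy (by omega)

theorem pmono_off {Λ : Fin n → Fin n → ℕ} (x : Fin n) (M : Rep k n Λ) :
    PMono (fun z => z ≠ x) M (reflPlus x Λ M) := by
  let g : ∀ z, (Fin (M.d z) → k) →ₗ[k] (Fin ((reflPlus x Λ M).d z) → k) :=
    fun z => if hz : z = x then 0 else (offE x Λ M hz).symm.toLinearMap
  have hg : ∀ z (hz : z ≠ x) v, offE x Λ M hz (g z v) = v := by
    intro z hz v
    simp [g, hz]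
  refine ⟨g, ?_, ?_⟩
  · intro z hz v w hvw
    rw [← hg z hz v, ← hg z hz w, hvw]
  · intro a b ha hb i j hij v
    apply (offE x Λ M hb).injective
    rw [hg b hb, refl_f_off x Λ M ha hb j i hij.symm, hg a ha]

/-- Deleting an isolated occurrence of `x` leaves a representation concentrated at `x`. -/
theorem off_zero {x : Fin n} {P Q : List (Fin n)} (hx : x ∉ Q) {Λ : Fin n → Fin n → ℕ}
    (M : Rep k n Λ) (ha : Admissible Λ (P ++ Q)) (hq : ∀ q ∈ Q, edges Λ x q = 0)
    (h : Annihilates Λ (P ++ x :: Q) M) : ∀ z, z ≠ x → (FList (P ++ Q) Λ M).d z = 0 := by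
  induction P generalizing Λ with
  | nil =>
    intro z hz
    have h1 := off_step hx ha (edges_flip x Λ).symm hq
      (fun a b h1 h2 => by simp [flipO, h1, h2]) (pmono_off x M)
    have h2 := pmono_d h1 hz
    have h3 : (FList Q (flipO x Λ) (reflPlus x Λ M)).d z = 0 := h z
    change (FList Q Λ M).d z = 0
    omega
  | cons y P ih => exact ih (reflPlus y Λ M) ha.2 (by rw [edges_flip]; exact hq) h

end PM
end KP

namespace KP
set_option linter.unusedSimpArgs false

section LinAlg
variable {k : Type} [Field k]

theorem exists_kernel_map {V : Type} [AddCommGroup V] [Module k V] [FiniteDimensional k V]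
    (W : Submodule k V) (m : ℕ) (hm : Module.finrank k V ≤ Module.finrank k W + m) :
    ∃ H : V →ₗ[k] (Fin m → k), LinearMap.ker H = W := by
  have h1 := W.finrank_quotient_add_finrank
  have h2 : Module.finrank k (V ⧸ W) ≤ Module.finrank k (Fin m → k) := by
    rw [Module.finrank_fin_fun]; omega
  obtain ⟨g, hg⟩ := finrank_le_iff_exists_linearMap.1 h2
  refine ⟨g ∘ₗ W.mkQ, ?_⟩
  rw [LinearMap.ker_comp_of_ker_eq_bot _ (LinearMap.ker_eq_bot.2 hg), Submodule.ker_mkQ]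

theorem idem_push {V U : Type} [AddCommGroup V] [Module k V] [FiniteDimensional k V]
    [AddCommGroup U] [Module k U]
    (h : V →ₗ[k] U) (E : V →ₗ[k] V) (hE : ∀ v, E (E v) = E v)
    (hk : ∀ v ∈ LinearMap.ker h, E v ∈ LinearMap.ker h) :
    ∃ e : U →ₗ[k] U, (∀ u, e (e u) = e u) ∧ (∀ v, e (h v) = h (E v)) ∧
      Module.finrank k (LinearMap.range e) +
        Module.finrank k (LinearMap.range (E.restrict hk)) =
          Module.finrank k (LinearMap.range E) := by
  obtain ⟨g0, hg0⟩ := h.rangeRestrict.exists_rightInverse_of_surjective (LinearMap.range_rangeRestrict h)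
  obtain ⟨g, hg⟩ := LinearMap.exists_extend g0
  have hgh : ∀ v, h (g (h v)) = h v := by
    intro v
    have h1 : g (h v) = g0 (h.rangeRestrict v) := by
      rw [← hg]; rfl
    have h2 : h.rangeRestrict (g0 (h.rangeRestrict v)) = h.rangeRestrict v := by
      rw [← LinearMap.comp_apply, hg0]; rfl
    rw [h1]
    exact congrArg Subtype.val h2
  have heh : ∀ v, h (E (g (h v))) = h (E v) := by
    intro v
    have h1 : g (h v) - v ∈ LinearMap.ker h := by
      rw [LinearMap.mem_ker, map_sub, hgh, sub_self]
    have h2 := hk _ h1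
    rw [LinearMap.mem_ker, map_sub, map_sub, sub_eq_zero] at h2
    exact h2
  refine ⟨h ∘ₗ E ∘ₗ g, ?_, heh, ?_⟩
  · intro u
    simp only [LinearMap.comp_apply]
    rw [heh, hE]
  · have r1 : LinearMap.range (h ∘ₗ E ∘ₗ g) = LinearMap.range (h.domRestrict (LinearMap.range E)) := by
      apply le_antisymm
      · rintro _ ⟨u, rfl⟩
        exact ⟨⟨E (g u), ⟨_, rfl⟩⟩, rfl⟩
      · rintro _ ⟨⟨_, ⟨v, rfl⟩⟩, rfl⟩
        exact ⟨h v, heh v⟩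
    have r2 : (LinearMap.range (E.restrict hk)).map (LinearMap.ker h).subtype =
        (LinearMap.ker (h.domRestrict (LinearMap.range E))).map (LinearMap.range E).subtype := by
      ext w
      constructor
      · rintro ⟨_, ⟨v, rfl⟩, rfl⟩
        refine ⟨⟨E v.1, ⟨_, rfl⟩⟩, ?_, rfl⟩
        exact hk _ v.2
      · rintro ⟨⟨_, ⟨v, rfl⟩⟩, hv, rfl⟩
        have hv' : E v ∈ LinearMap.ker h := hv
        refine ⟨⟨E v, hv'⟩, ⟨⟨E v, hv'⟩, ?_⟩, rfl⟩
        apply Subtype.ext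
        exact hE v
    have r3 : Module.finrank k (LinearMap.range (E.restrict hk)) =
        Module.finrank k (LinearMap.ker (h.domRestrict (LinearMap.range E))) := by
      rw [← Submodule.finrank_map_subtype_eq, r2, Submodule.finrank_map_subtype_eq]
    rw [r1, r3]
    exact LinearMap.finrank_range_add_finrank_ker _

theorem finrank_range_pi {ι : Type} [Fintype ι] {d : ι → ℕ}
    (e : ∀ p, (Fin (d p) → k) →ₗ[k] (Fin (d p) → k))
    (E : (∀ p, (Fin (d p) → k)) →ₗ[k] (∀ p, (Fin (d p) → k))) (hE : ∀ v p, E v p = e p (v p)) :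
    Module.finrank k (LinearMap.range E) = ∑ p, Module.finrank k (LinearMap.range (e p)) := by
  let L : (∀ p, LinearMap.range (e p)) →ₗ[k] (∀ p, (Fin (d p) → k)) :=
    LinearMap.pi fun p => (LinearMap.range (e p)).subtype ∘ₗ LinearMap.proj p
  have hL : ∀ v p, L v p = (v p).1 := fun v p => rfl
  have hi : Function.Injective L := by
    intro v w hvw
    funext p
    apply Subtype.ext
    rw [← hL, ← hL, hvw]
  have hr : LinearMap.range L = LinearMap.range E := by
    apply le_antisymm
    · rintro _ ⟨v, rfl⟩
      choose u hu using fun p => (v p).2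
      refine ⟨u, ?_⟩
      funext p
      rw [hE, hL, hu]
    · rintro _ ⟨v, rfl⟩
      refine ⟨fun p => ⟨e p (v p), ⟨_, rfl⟩⟩, ?_⟩
      funext p
      rw [hE, hL]
  rw [← hr, LinearMap.finrank_range_of_inj hi, Module.finrank_pi_fintype]

theorem finrank_range_conj {V U : Type} [AddCommGroup V] [Module k V]
    [AddCommGroup U] [Module k U] (φ : V ≃ₗ[k] U) (e : V →ₗ[k] V) (e' : U →ₗ[k] U)
    (h : ∀ v, φ (e v) = e' (φ v)) :
    Module.finrank k (LinearMap.range e) = Module.finrank k (LinearMap.range e') := by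
  have : LinearMap.range e' = (LinearMap.range e).map φ.toLinearMap := by
    ext w
    constructor
    · rintro ⟨u, rfl⟩
      refine ⟨e (φ.symm u), ⟨_, rfl⟩, ?_⟩
      rw [LinearEquiv.coe_coe, h, LinearEquiv.apply_symm_apply]
    · rintro ⟨_, ⟨v, rfl⟩, rfl⟩
      exact ⟨φ v, (h v).symm⟩
  rw [this]
  exact (LinearEquiv.finrank_map_eq φ _).symm

end LinAlg

section IdemSec
variable {k : Type} [Field k] {n : ℕ}

/-- There is an idempotent endomorphism with rank vector `r`. -/
def Idem {Λ : Fin n → Fin n → ℕ} (M : Rep k n Λ) (r : Fin n → ℤ) : Prop :=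
  ∃ e : ∀ z, (Fin (M.d z) → k) →ₗ[k] (Fin (M.d z) → k),
    (∀ z v, e z (e z v) = e z v) ∧
    (∀ a b i v, e b (M.f a b i v) = M.f a b i (e a v)) ∧
    ∀ z, (Module.finrank k (LinearMap.range (e z)) : ℤ) = r z

theorem idem_nonneg {Λ : Fin n → Fin n → ℕ} {M : Rep k n Λ} {r : Fin n → ℤ} (h : Idem M r) :
    0 ≤ r := by
  obtain ⟨e, _, _, h3⟩ := h
  intro z
  rw [← h3]
  exact Int.natCast_nonneg _

theorem idem_dimv {Λ : Fin n → Fin n → ℕ} (M : Rep k n Λ) : Idem M (dimv M) := by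
  refine ⟨fun z => LinearMap.id, fun _ _ => rfl, fun _ _ _ _ => rfl, fun z => ?_⟩
  rw [LinearMap.range_id, finrank_top, Module.finrank_fin_fun]
  rfl

variable (A : Fin n → Fin n → ℤ) (hA : ∀ i, A i i = 2)

theorem idem_refl {x : Fin n} {Λ : Fin n → Fin n → ℕ} (hc : cartanOf Λ = A)
    (hx : IsSink Λ x) (M : Rep k n Λ) {r : Fin n → ℤ} (h : Idem (reflPlus x Λ M) r) :
    Idem M (sigmaE A hA x r) := by
  obtain ⟨e, h1, h2, h3⟩ := h
  let e0 : ∀ z, (Fin (M.d z) → k) →ₗ[k] (Fin (M.d z) → k) :=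
    fun z => if hz : z = x then 0
      else (offE x Λ M hz).toLinearMap ∘ₗ e z ∘ₗ (offE x Λ M hz).symm.toLinearMap
  have he0 : ∀ z (hz : z ≠ x) v, e0 z (offE x Λ M hz v) = offE x Λ M hz (e z v) := by
    intro z hz v
    simp [e0, hz]
  have hrank0 : ∀ z (hz : z ≠ x), (Module.finrank k (LinearMap.range (e0 z)) : ℤ) = r z := by
    intro z hz
    rw [← h3 z, finrank_range_conj (offE x Λ M hz) (e z) (e0 z) (fun v => (he0 z hz v).symm)]
  have hidem0 : ∀ z (hz : z ≠ x) v, e0 z (e0 z v) = e0 z v := by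
    intro z hz v
    obtain ⟨w, rfl⟩ := (offE x Λ M hz).surjective v
    rw [he0 z hz, he0 z hz, h1]
  have hpx : ∀ p : Arin Λ x, p.1 ≠ x := by
    intro p hp
    have h0 : Λ p.1 x = 0 := by rw [hp]; exact hx x
    exact (Fin.cast h0 p.2).elim0
  let E : ((p : Arin Λ x) → (Fin (M.d p.1) → k)) →ₗ[k] ((p : Arin Λ x) → (Fin (M.d p.1) → k)) :=
    LinearMap.pi fun p => (e0 p.1) ∘ₗ LinearMap.proj (φ := fun p : Arin Λ x => Fin (M.d p.1) → k) p
  have hE : ∀ v p, E v p = e0 p.1 (v p) := fun v p => rfl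
  have hEE : ∀ v, E (E v) = E v := by
    intro v
    funext p
    rw [hE, hE, hidem0 _ (hpx p)]
  have hon : ∀ v, E (onE x Λ M v).1 = (onE x Λ M (e x v)).1 := by
    intro v
    funext ⟨b, j⟩
    have hb : b ≠ x := hpx ⟨b, j⟩
    have e1 : Λ b x = flipO x Λ x b := by simp [flipO]
    rw [hE, ← refl_f_on x Λ M hb (Fin.cast e1 j) j rfl, ← refl_f_on x Λ M hb (Fin.cast e1 j) j rfl,
      he0 b hb, h2]
  have hk : ∀ v ∈ LinearMap.ker (inMap Λ M x), E v ∈ LinearMap.ker (inMap Λ M x) := by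
    intro v hv
    obtain ⟨w, hw⟩ := (onE x Λ M).surjective ⟨v, hv⟩
    have : v = (onE x Λ M w).1 := by rw [hw]
    rw [this, hon]
    exact (onE x Λ M (e x w)).2
  obtain ⟨ex, k1, k2, k3⟩ := idem_push (inMap Λ M x) E hEE hk
  have k4 : (Module.finrank k (LinearMap.range (E.restrict hk)) : ℤ) = r x := by
    rw [← h3 x, finrank_range_conj (onE x Λ M) (e x) (E.restrict hk)]
    intro v
    apply Subtype.ext
    exact (hon v).symm
  have k5 : (Module.finrank k (LinearMap.range E) : ℤ) = ∑ y, (Λ y x : ℤ) * r y := by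
    rw [finrank_range_pi (fun p : Arin Λ x => e0 p.1) E hE, Fintype.sum_sigma]
    push_cast
    refine Finset.sum_congr rfl fun y _ => ?_
    by_cases hy : y = x
    · subst hy
      refine (Finset.sum_eq_zero fun i _ => (Fin.cast (hx y) i).elim0).trans ?_
      simp [hx y]
    · simp [hrank0 y hy]
  obtain ⟨e', hex, heo⟩ : ∃ e' : ∀ z, (Fin (M.d z) → k) →ₗ[k] (Fin (M.d z) → k),
      e' x = ex ∧ ∀ z, z ≠ x → e' z = e0 z :=
    ⟨Function.update e0 x ex, Function.update_self _ _ _, fun z hz => Function.update_of_ne hz _ _⟩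
  refine ⟨e', ?_, ?_, ?_⟩
  · intro z v
    by_cases hz : z = x
    · subst hz; rw [hex]; exact k1 v
    · rw [heo z hz]; exact hidem0 z hz v
  · intro a b i v
    by_cases ha : a = x
    · exfalso
      subst ha
      have := hx b
      rw [this] at i
      exact i.elim0
    by_cases hb : b = x
    · subst hb
      rw [hex, heo a ha, ← inMap_single b Λ M ⟨a, i⟩, k2, ← inMap_single b Λ M ⟨a, i⟩]
      congr 1
      funext p
      rw [hE]
      by_cases hp : p = ⟨a, i⟩
      · subst hp; simp
      · simp [Pi.single_eq_of_ne hp]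
    · rw [heo a ha, heo b hb]
      obtain ⟨w, rfl⟩ := (offE x Λ M ha).surjective v
      have e1 : Λ a b = flipO x Λ a b := by simp [flipO, ha, hb]
      rw [he0 a ha, ← refl_f_off x Λ M ha hb (Fin.cast e1 i) i rfl,
        ← refl_f_off x Λ M ha hb (Fin.cast e1 i) i rfl, he0 b hb, h2]
  · intro z
    by_cases hz : z = x
    · subst hz
      rw [hex, sigma_sink A hA hc (hx z) hx, ← k5, ← k4, ← k3]
      push_cast
      ring
    · rw [heo z hz, sigmaE_of_ne A hA x r hz, hrank0 z hz]

theorem idem_list {Λ : Fin n → Fin n → ℕ} (hc : cartanOf Λ = A) {S : List (Fin n)}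
    (hS : Admissible Λ S) (M : Rep k n Λ) {r : Fin n → ℤ} (h : Idem (FList S Λ M) r) :
    Idem M (pw A hA S r) := by
  induction S generalizing Λ with
  | nil => exact h
  | cons x xs ih =>
    rw [pw_cons_apply]
    exact idem_refl A hA hc hS.1 M (ih (by rw [cartan_flip, hc]) hS.2 _ h)

theorem idem_suffix {Λ : Fin n → Fin n → ℕ} (hc : cartanOf Λ = A) {S : List (Fin n)}
    (hS : Admissible Λ S) (M : Rep k n Λ) {r : Fin n → ℤ} (h : Idem (FList S Λ M) r)
    (P1 P2 : List (Fin n)) (hP : S = P1 ++ P2) : 0 ≤ pw A hA P2 r := by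
  induction S generalizing Λ P1 with
  | nil =>
    have := List.append_eq_nil_iff.1 hP.symm
    rw [this.2]
    exact idem_nonneg h
  | cons x xs ih =>
    rcases P1 with _ | ⟨y, P1⟩
    · have e : P2 = x :: xs := by simpa using hP.symm
      rw [e]
      exact idem_nonneg (idem_list A hA hc hS M h)
    · simp only [List.cons_append, List.cons.injEq] at hP
      exact ih (by rw [cartan_flip, hc]) hS.2 _ h P1 hP.2

end IdemSec
end KP

namespace KP
set_option linter.unusedSimpArgs false

section Ext
variable {k : Type} [Field k] {n : ℕ}

/-- The map out of `x` indexed by the arrows of `Λ` ending at `x`. -/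
noncomputable def outR (x : Fin n) (Λ : Fin n → Fin n → ℕ) (N : Rep k n (flipO x Λ)) :
    (Fin (N.d x) → k) →ₗ[k] ((p : Arin Λ x) → (Fin (N.d p.1) → k)) :=
  LinearMap.pi fun p => N.f x p.1 (Fin.cast (by simp [flipO]) p.2)

theorem outR_apply (x : Fin n) (Λ : Fin n → Fin n → ℕ) (N : Rep k n (flipO x Λ)) (v : Fin (N.d x) → k)
    (b : Fin n) (j : Fin (Λ b x)) (i : Fin (flipO x Λ x b)) (hij : i.val = j.val) :
    outR x Λ N v ⟨b, j⟩ = N.f x b i v := by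
  have e : (Fin.cast (by simp [flipO]) j : Fin (flipO x Λ x b)) = i := Fin.ext hij.symm
  rw [← e]
  rfl

/-- A representation with prescribed map into the sink `x`. -/
noncomputable def extRep (x : Fin n) (Λ : Fin n → Fin n → ℕ) (N : Rep k n (flipO x Λ)) (m : ℕ)
    (H : ((p : Arin Λ x) → (Fin (N.d p.1) → k)) →ₗ[k] (Fin m → k)) : Rep k n Λ where
  d z := if z = x then m else N.d z
  f a b i :=
    if hb : b = x then
      if ha : a = x then 0
      else
        (castL k (if_pos hb).symm).toLinearMap ∘ₗ H ∘ₗ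
          (LinearMap.single k (fun p : Arin Λ x => Fin (N.d p.1) → k)
            (⟨a, Fin.cast (by rw [hb]) i⟩ : Arin Λ x)) ∘ₗ
          (castL k (if_neg ha)).toLinearMap
    else
      if ha : a = x then 0
      else
        (castL k (if_neg hb).symm).toLinearMap ∘ₗ
          N.f a b (Fin.cast (by simp [flipO, ha, hb]) i) ∘ₗ
          (castL k (if_neg ha)).toLinearMap

variable (x : Fin n) (Λ : Fin n → Fin n → ℕ) (N : Rep k n (flipO x Λ)) (m : ℕ)
    (H : ((p : Arin Λ x) → (Fin (N.d p.1) → k)) →ₗ[k] (Fin m → k))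

/-- Identification away from `x`. -/
noncomputable def offG {z : Fin n} (hz : z ≠ x) :
    (Fin ((extRep x Λ N m H).d z) → k) ≃ₗ[k] (Fin (N.d z) → k) := castL k (if_neg hz)

/-- Identification at `x`. -/
noncomputable def onG : (Fin ((extRep x Λ N m H).d x) → k) ≃ₗ[k] (Fin m → k) :=
  castL k (if_pos rfl)

theorem ext_f_off {a b : Fin n} (ha : a ≠ x) (hb : b ≠ x) (i : Fin (Λ a b))
    (j : Fin (flipO x Λ a b)) (hij : i.val = j.val) (v : Fin ((extRep x Λ N m H).d a) → k) :
    offG x Λ N m H hb ((extRep x Λ N m H).f a b i v) = N.f a b j (offG x Λ N m H ha v) := by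
  have e : (Fin.cast (by simp [flipO, ha, hb]) i : Fin (flipO x Λ a b)) = j := Fin.ext hij
  have h1 : (extRep x Λ N m H).f a b i = (offG x Λ N m H hb).symm.toLinearMap ∘ₗ N.f a b j ∘ₗ
      (offG x Λ N m H ha).toLinearMap := by
    rw [← e]
    exact (dif_neg hb).trans (dif_neg ha)
  rw [h1]
  simp

theorem ext_f_on {a : Fin n} (ha : a ≠ x) (i : Fin (Λ a x))
    (v : Fin ((extRep x Λ N m H).d a) → k) :
    onG x Λ N m H ((extRep x Λ N m H).f a x i v) =
      H (LinearMap.single k (fun p : Arin Λ x => Fin (N.d p.1) → k) ⟨a, i⟩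
        (offG x Λ N m H ha v)) := by
  have h1 : (extRep x Λ N m H).f a x i = (onG x Λ N m H).symm.toLinearMap ∘ₗ H ∘ₗ
      (LinearMap.single k (fun p : Arin Λ x => Fin (N.d p.1) → k) ⟨a, i⟩) ∘ₗ
      (offG x Λ N m H ha).toLinearMap :=
    (dif_pos rfl).trans (dif_neg ha)
  rw [h1]
  simp

theorem arin_ne {x : Fin n} {Λ : Fin n → Fin n → ℕ} (hx : IsSink Λ x) (p : Arin Λ x) : p.1 ≠ x := by
  intro hp
  have h0 : Λ p.1 x = 0 := by rw [hp]; exact hx x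
  exact (Fin.cast h0 p.2).elim0

theorem ext_inMap (hx : IsSink Λ x)
    (v : (p : Arin Λ x) → (Fin ((extRep x Λ N m H).d p.1) → k)) :
    onG x Λ N m H (inMap Λ (extRep x Λ N m H) x v) =
      H (fun p => offG x Λ N m H (arin_ne hx p) (v p)) := by
  rw [inMap_apply, map_sum]
  conv_rhs => rw [← Finset.univ_sum_single (fun p : Arin Λ x => offG x Λ N m H (arin_ne hx p) (v p)), map_sum]
  refine Finset.sum_congr rfl fun p _ => ?_
  exact ext_f_on x Λ N m H (arin_ne hx p) p.2 (v p)

theorem ext_pmono (hx : IsSink Λ x) (hi : Function.Injective (outR x Λ N))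
    (hH : LinearMap.ker H = LinearMap.range (outR x Λ N)) :
    PMono (fun _ => True) (reflPlus x Λ (extRep x Λ N m H)) N := by
  obtain ⟨s, hs⟩ := LinearMap.exists_leftInverse_of_injective _ (LinearMap.ker_eq_bot.2 hi)
  have hs' : ∀ w, s (outR x Λ N w) = w := fun w => by
    rw [← LinearMap.comp_apply, hs]; rfl
  let T : ((p : Arin Λ x) → (Fin ((extRep x Λ N m H).d p.1) → k)) →ₗ[k]
      ((p : Arin Λ x) → (Fin (N.d p.1) → k)) :=
    LinearMap.pi fun p => (offG x Λ N m H (arin_ne hx p)).toLinearMap ∘ₗ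
      LinearMap.proj (φ := fun p : Arin Λ x => Fin ((extRep x Λ N m H).d p.1) → k) p
  have hT : ∀ v p, T v p = offG x Λ N m H (arin_ne hx p) (v p) := fun v p => rfl
  have hTi : Function.Injective T := by
    intro v w hvw
    funext p
    have := congrFun hvw p
    rw [hT, hT] at this
    exact (offG x Λ N m H (arin_ne hx p)).injective this
  let g0 : ∀ z, (Fin ((reflPlus x Λ (extRep x Λ N m H)).d z) → k) →ₗ[k] (Fin (N.d z) → k) :=
    fun z => if hz : z = x then 0
    else (offG x Λ N m H hz).toLinearMap ∘ₗ (offE x Λ (extRep x Λ N m H) hz).toLinearMap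
  obtain ⟨g, hgx, hgo⟩ : ∃ g : ∀ z, (Fin ((reflPlus x Λ (extRep x Λ N m H)).d z) → k) →ₗ[k]
      (Fin (N.d z) → k),
      g x = s ∘ₗ T ∘ₗ (LinearMap.ker (inMap Λ (extRep x Λ N m H) x)).subtype ∘ₗ
        (onE x Λ (extRep x Λ N m H)).toLinearMap ∧
        ∀ z, z ≠ x → g z = g0 z :=
    ⟨Function.update g0 x _, Function.update_self _ _ _, fun z hz => Function.update_of_ne hz _ _⟩
  have h1 : ∀ v, outR x Λ N (g x v) = T (onE x Λ (extRep x Λ N m H) v).1 := by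
    intro v
    have h2 : T (onE x Λ (extRep x Λ N m H) v).1 ∈ LinearMap.ker H := by
      have h3 := (onE x Λ (extRep x Λ N m H) v).2
      rw [LinearMap.mem_ker] at h3 ⊢
      have h4 := ext_inMap x Λ N m H hx (onE x Λ (extRep x Λ N m H) v).1
      rw [h3, map_zero] at h4
      exact h4.symm
    rw [hH] at h2
    obtain ⟨w, hw⟩ := h2
    have h5 : g x v = s (T (onE x Λ (extRep x Λ N m H) v).1) := by rw [hgx]; rfl
    rw [h5, ← hw, hs']
  have h2 : ∀ z (hz : z ≠ x) v, g z v = offG x Λ N m H hz (offE x Λ (extRep x Λ N m H) hz v) := by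
    intro z hz v
    simp [hgo z hz, g0, hz]
  refine ⟨g, ?_, ?_⟩
  · intro z _
    by_cases hz : z = x
    · subst hz
      intro v w hvw
      have := congrArg (outR z Λ N) hvw
      rw [h1, h1] at this
      exact (onE z Λ (extRep z Λ N m H)).injective (Subtype.ext (hTi this))
    · intro v w hvw
      rw [h2 z hz, h2 z hz] at hvw
      exact (offE x Λ _ hz).injective ((offG x Λ N m H hz).injective hvw)
  · intro a b _ _ i j hij v
    obtain rfl : i = j := Fin.ext hij
    by_cases hb : b = x
    · exfalso
      subst hb
      have h0 : flipO b Λ a b = 0 := by simp [flipO, hx a]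
      exact (Fin.cast h0 i).elim0
    rw [h2 b hb]
    by_cases ha : a = x
    · subst ha
      have e1 : flipO a Λ a b = Λ b a := by simp [flipO]
      rw [refl_f_on a Λ _ hb i (Fin.cast e1 i) rfl, ← outR_apply a Λ N _ b (Fin.cast e1 i) i rfl, h1, hT]
    · have e1 : flipO x Λ a b = Λ a b := by simp [flipO, ha, hb]
      rw [refl_f_off x Λ _ ha hb i (Fin.cast e1 i) rfl, ext_f_off x Λ N m H ha hb _ i rfl, h2 a ha]

end Ext

section Main
variable {k : Type} [Field k] {n : ℕ} (A : Fin n → Fin n → ℤ) (hA : ∀ i, A i i = 2)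

theorem outR_inj {x : Fin n} {xs : List (Fin n)} {Λ : Fin n → Fin n → ℕ} (hc : cartanOf Λ = A)
    (hS : Admissible Λ (x :: xs)) (hr : Red A hA (x :: xs)) (N : Rep k n (flipO x Λ))
    (hN : Annihilates (flipO x Λ) xs N) : Function.Injective (outR x Λ N) := by
  rw [← LinearMap.ker_eq_bot, LinearMap.ker_eq_bot']
  intro v hv
  by_contra hne
  have hsym : ∀ i j, A i j = A j i := by rw [← hc]; exact cartan_symm Λ
  have hneg : ∀ i j, i ≠ j → A i j ≤ 0 := by rw [← hc]; exact cartan_neg Λ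
  obtain ⟨g, hgx, hgo⟩ : ∃ g : ∀ z, (Fin ((simpleRep (k := k) (flipO x Λ) x).d z) → k) →ₗ[k]
      (Fin (N.d z) → k),
      g x = (LinearMap.toSpanSingleton k _ v) ∘ₗ
        (LinearMap.proj (⟨0, by simp [simpleRep]⟩ : Fin ((simpleRep (k := k) (flipO x Λ) x).d x))) ∧
        ∀ z, z ≠ x → g z = 0 :=
    ⟨Function.update (fun _ => 0) x _, Function.update_self _ _ _,
      fun z hz => Function.update_of_ne hz _ _⟩
  have hd : (simpleRep (k := k) (flipO x Λ) x).d x = 1 := if_pos rfl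
  have hP : PMono (fun _ => True) (simpleRep (flipO x Λ) x) N := by
    refine ⟨g, ?_, ?_⟩
    · intro z _
      by_cases hz : z = x
      · subst hz
        intro u w huw
        rw [hgx] at huw
        simp only [LinearMap.comp_apply, LinearMap.proj_apply, LinearMap.toSpanSingleton_apply] at huw
        have h1 := smul_left_injective k hne huw
        funext i
        have : i = ⟨0, by simp [simpleRep]⟩ := Fin.ext (by have := i.2; omega)
        rw [this]
        exact h1
      · intro u w _
        have h0 : (simpleRep (k := k) (flipO x Λ) x).d z = 0 := if_neg hz
        funext i
        exact (Fin.cast h0 i).elim0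
    · intro a b _ _ i j hij u
      have h0 : (simpleRep (k := k) (flipO x Λ) x).f a b i u = 0 := rfl
      rw [h0, map_zero]
      by_cases ha : a = x
      · subst ha
        have e1 : flipO a Λ a b = Λ b a := by simp [flipO]
        have h2 := congrFun hv ⟨b, Fin.cast e1 j⟩
        rw [outR_apply a Λ N v b _ j rfl] at h2
        rw [hgx]
        simp only [LinearMap.comp_apply, LinearMap.proj_apply, LinearMap.toSpanSingleton_apply,
          map_smul, h2]
        simp
      · rw [hgo a ha]
        simp
  have h1 := ann_nonpos A hA (by rw [cartan_flip, hc]) hS.2 (Red.right A hA (xs := [x]) hr) _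
    (ann_sub hS.2 hP hN)
  have h2 : dimv (simpleRep (k := k) (flipO x Λ) x) = sroot x := by
    funext z
    by_cases hz : z = x
    · subst hz; simp [dimv, hd, sroot_self]
    · simp [dimv, simpleRep, hz, sroot_of_ne hz]
  rw [h2] at h1
  have h3 := le_antisymm h1 (red_word_nonneg A hA hsym hneg hr)
  exact sroot_ne_zero x ((LinearEquiv.map_eq_zero_iff _).1 h3)

theorem exists_max {S : List (Fin n)} : ∀ {Λ : Fin n → Fin n → ℕ}, cartanOf Λ = A →
    Admissible Λ S → Red A hA S →
    ∃ M : Rep k n Λ, Annihilates Λ S M ∧ dimv M = vmax A hA S := by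
  induction S with
  | nil =>
    intro Λ _ _ _
    exact ⟨zeroRep k n Λ, fun _ => rfl, by funext z; simp [dimv, zeroRep, vmax]⟩
  | cons x xs ih =>
    intro Λ hc hS hr
    obtain ⟨N, hN, hd⟩ := ih (by rw [cartan_flip, hc]) hS.2 (Red.right A hA (xs := [x]) hr)
    have hi := outR_inj A hA hc hS hr N hN
    have hle : N.d x ≤ ∑ y, Λ y x * N.d y := by
      have := LinearMap.finrank_le_finrank_of_injective hi
      rw [finrank_arin x Λ N.d, Module.finrank_fin_fun] at this
      exact this
    have key : ∀ ε : ℕ, ∃ M : Rep k n Λ, Annihilates Λ (x :: xs) M ∧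
        dimv M = sigmaE A hA x (dimv N) + (ε : ℤ) • sroot x := by
      intro ε
      obtain ⟨H, hH⟩ := exists_kernel_map (LinearMap.range (outR x Λ N))
        ((∑ y, Λ y x * N.d y) - N.d x + ε) (by
          rw [LinearMap.finrank_range_of_inj hi, finrank_arin x Λ N.d, Module.finrank_fin_fun]
          omega)
      have hann : Annihilates (flipO x Λ) xs (reflPlus x Λ (extRep x Λ N _ H)) :=
        ann_sub hS.2 (ext_pmono x Λ N _ H hS.1 hi hH) hN
      refine ⟨extRep x Λ N _ H, hann, ?_⟩
      funext z
      by_cases hz : z = x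
      · subst hz
        have h3 : (∑ y, (Λ y z : ℤ) * dimv N y) = ((∑ y, Λ y z * N.d y : ℕ) : ℤ) := by
          simp [dimv]
        rw [Pi.add_apply, sigma_sink A hA hc (hS.1 z) hS.1, h3]
        simp only [dimv, extRep, if_true, Pi.smul_apply, sroot_self, smul_eq_mul, mul_one]
        omega
      · simp [sroot_of_ne hz, sigmaE_of_ne A hA x _ hz, dimv, extRep, hz]
    rw [vmax, ← hd]
    split_ifs
    · simpa using key 1
    · simpa using key 0

theorem red_imp_short {Λ : Fin n → Fin n → ℕ} {S : List (Fin n)} (hS : Admissible Λ S)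
    (hr : CRed Λ S) : ∃ M : Rep k n Λ, Preprojective Λ M ∧ IsShortestAnn Λ M S := by
  obtain ⟨M, hM, hd⟩ := exists_max (k := k) (cartanOf Λ) (cartan_diag Λ) rfl hS hr
  refine ⟨M, ⟨S, hS, hM⟩, hS, hM, ?_⟩
  rintro S' hS' hM' ⟨U, hU, hsim⟩
  by_cases hU0 : U = []
  · subst hU0
    rw [List.append_nil] at hsim
    exact sim_symm (edges_symm Λ) hsim
  exfalso
  have hr' : Red (cartanOf Λ) (cartan_diag Λ) (S' ++ U) := cred_sim hsim hr
  obtain ⟨X, _, hX⟩ := exists_max (k := k) (cartanOf Λ) (cartan_diag Λ)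
    (cartan_orientAfter Λ S') hU (Red.right _ _ hr')
  have h1 := vmax_ne_zero (cartanOf Λ) (cartan_diag Λ) (cartan_symm Λ) hU0
  obtain ⟨z, hz⟩ := Function.ne_iff.1 h1
  have hzU : z ∈ U := by
    by_contra h
    exact hz (vmax_supp _ _ h)
  have h2 := ann_nonpos _ _ rfl hS' (Red.left _ _ hr') M hM' z
  rw [hd, vmax_sim hsim, vmax_append _ _ (cartan_symm Λ) S' U hzU] at h2
  have h3 : (0 : ℤ) ≤ dimv X z := Int.natCast_nonneg _
  rw [hX] at h3
  exact hz (le_antisymm h2 h3)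

theorem short_imp_red {Λ : Fin n → Fin n → ℕ} (hl : ∀ a, Λ a a = 0)
    (hnb : ∀ a, ∃ b, edges Λ a b ≠ 0) {S : List (Fin n)} (M : Rep k n Λ)
    (h : IsShortestAnn Λ M S) : CRed Λ S := by
  obtain ⟨hS, hM, hmin⟩ := h
  refine red_of_isol hl hnb hS ?_
  rintro P x Q rfl hiso P1 P2 rfl
  have hxQ : x ∉ Q := isol_not_mem _ (cartan_diag Λ) hiso
  have hq : ∀ q ∈ Q, edges Λ x q = 0 := by
    intro q hq
    have h1 := hiso q hq
    have h2 : x ≠ q := fun e => hxQ (e ▸ hq)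
    simpa [cartanOf, h2] using h1
  have hsim := sim_to_end x (P1 ++ P2) Q hq
  have hadm := admissible_sim hsim hS
  rw [admissible_append] at hadm
  have hnot : ¬ Annihilates Λ ((P1 ++ P2) ++ Q) M := by
    intro hann
    have h1 := hmin _ hadm.1 hann ⟨[x], hadm.2, hsim⟩
    have h2 := (sim_perm h1).length_eq
    simp at h2
  have hoff := off_zero hxQ M hadm.1 hq hM
  have hc : dimv (FList ((P1 ++ P2) ++ Q) Λ M) =
      ((FList ((P1 ++ P2) ++ Q) Λ M).d x : ℤ) • sroot x := by
    funext z
    by_cases hz : z = x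
    · subst hz; simp [dimv, sroot_self]
    · simp [dimv, hoff z hz, sroot_of_ne hz]
  have hpos : (0 : ℤ) < ((FList ((P1 ++ P2) ++ Q) Λ M).d x : ℤ) := by
    by_contra h0
    apply hnot
    intro z
    by_cases hz : z = x
    · subst hz; omega
    · exact hoff z hz
  have h1 := idem_suffix (cartanOf Λ) (cartan_diag Λ) rfl hadm.1 M (idem_dimv _) P1 (P2 ++ Q)
    (by simp)
  rw [hc, map_smul, pw_append_apply, pw_isol _ _ (cartan_symm Λ) hiso] at h1
  intro z
  have h2 := h1 z
  simp only [Pi.smul_apply, smul_eq_mul, Pi.zero_apply] at h2 ⊢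
  exact nonneg_of_mul_nonneg_right h2 hpos

theorem exists_nb (hn : 2 ≤ n) {Λ : Fin n → Fin n → ℕ}
    (hconn : ∀ a b, Relation.ReflTransGen (fun u v => edges Λ u v ≠ 0) a b) (a : Fin n) :
    ∃ b, edges Λ a b ≠ 0 := by
  have : Nontrivial (Fin n) := Fin.nontrivial_iff_two_le.2 hn
  obtain ⟨b, hb⟩ := exists_ne a
  rcases Relation.ReflTransGen.cases_head (hconn a b) with h | ⟨c, hc, _⟩
  · exact absurd h.symm hb
  · exact ⟨c, hc⟩

end Main
end KP

namespace KP

theorem admissible_reduced_iff_shortest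
    (n : ℕ) (hn : 2 ≤ n) (Λ : Fin n → Fin n → ℕ)
    (hloop : ∀ a, Λ a a = 0)
    (hconn : ∀ a b : Fin n, Relation.ReflTransGen (fun u v => edges Λ u v ≠ 0) a b)
    (hacyc : ∀ a : Fin n, ¬ Relation.TransGen (fun u v => Λ u v ≠ 0) a a)
    (k : Type) [Field k]
    (S : List (Fin n)) (hS : Admissible Λ S) :
    ((∃ M : Rep k n Λ, Preprojective Λ M ∧ IsShortestAnn Λ M S) ↔ IsReducedSeq Λ S) ∧
    (S ≠ [] → ∀ Ts : List (List (Fin n)),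
      (∀ T ∈ Ts, IsPrincipal Λ T) → IsJoinList Λ Ts S →
      (∀ Ts' : List (List (Fin n)), (∀ T ∈ Ts', IsPrincipal Λ T) → IsJoinList Λ Ts' S →
        Ts.length ≤ Ts'.length) →
      (IsReducedSeq Λ S ↔ ∀ T ∈ Ts, IsReducedSeq Λ T)) := by
  refine ⟨⟨?_, ?_⟩, ?_⟩
  · rintro ⟨M, _, hM⟩
    rw [reduced_iff_red]
    exact short_imp_red hloop (exists_nb hn hconn) M hM
  · intro h
    rw [reduced_iff_red] at h
    exact red_imp_short hS h
  · intro _ Ts _ hJ _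
    simp only [reduced_iff_red]
    exact cred_joinList hJ

end KP
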